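/- arXiv:2509.19138 — 9 statements merged into one kernel-verified Lean document; each statement's English description precedes it below -/
import Mathlib

section
/- Let Y be a measurable space and (Aₙ)ₙ an increasing sequence of measurable sets with ⋃ₙ Aₙ = Y. Let ν be a real-valued set function defined on the collection ⋃ₙ {B measurable : B ⊆ Aₙ} such that for every n the restriction of ν to measurable subsets of Aₙ is a finite signed Borel measure (countably additive). Then there exists a unique pair (μ⁺, μ⁻) of mutually singular σ-finite positive Borel measures on Y such that ν(B) = μ⁺(B) − μ⁻(B) for every measurable B contained in some Aₙ. -/
open MeasureTheory Filter Topology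
open scoped ENNReal

theorem aux_unique {Y : Type*} [MeasurableSpace Y]
    (A : ℕ → Set Y) (hAmeas : ∀ n, MeasurableSet (A n))
    (hAunion : ⋃ n, A n = Set.univ) (ν : Set Y → ℝ) (p q : Measure Y × Measure Y)
    (hp : p.1 ⟂ₘ p.2) (hq : q.1 ⟂ₘ q.2)
    (hpν : ∀ n, ∀ B : Set Y, MeasurableSet B → B ⊆ A n →
        p.1 B < ⊤ ∧ p.2 B < ⊤ ∧ ν B = (p.1 B).toReal - (p.2 B).toReal)
    (hqν : ∀ n, ∀ B : Set Y, MeasurableSet B → B ⊆ A n →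
        q.1 B < ⊤ ∧ q.2 B < ⊤ ∧ ν B = (q.1 B).toReal - (q.2 B).toReal) : p = q := by
  have key : ∀ n, p.1.restrict (A n) = q.1.restrict (A n) ∧
      p.2.restrict (A n) = q.2.restrict (A n) := by
    intro n
    have f1 : IsFiniteMeasure (p.1.restrict (A n)) :=
      ⟨by simpa using (hpν n _ (hAmeas n) subset_rfl).1⟩
    have f2 : IsFiniteMeasure (p.2.restrict (A n)) :=
      ⟨by simpa using (hpν n _ (hAmeas n) subset_rfl).2.1⟩
    have f3 : IsFiniteMeasure (q.1.restrict (A n)) :=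
      ⟨by simpa using (hqν n _ (hAmeas n) subset_rfl).1⟩
    have f4 : IsFiniteMeasure (q.2.restrict (A n)) :=
      ⟨by simpa using (hqν n _ (hAmeas n) subset_rfl).2.1⟩
    let j₁ : JordanDecomposition Y :=
      ⟨p.1.restrict (A n), p.2.restrict (A n),
        (hp.mono Measure.restrict_le_self Measure.restrict_le_self)⟩
    let j₂ : JordanDecomposition Y :=
      ⟨q.1.restrict (A n), q.2.restrict (A n),
        (hq.mono Measure.restrict_le_self Measure.restrict_le_self)⟩
    have h : j₁ = j₂ := by
      apply JordanDecomposition.toSignedMeasure_injective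
      ext B hB
      rw [JordanDecomposition.toSignedMeasure, JordanDecomposition.toSignedMeasure,
        Measure.toSignedMeasure_sub_apply hB, Measure.toSignedMeasure_sub_apply hB]
      simp only [j₁, j₂, measureReal_def, Measure.restrict_apply hB]
      have hm := hB.inter (hAmeas n)
      rw [← (hpν n _ hm Set.inter_subset_right).2.2, ← (hqν n _ hm Set.inter_subset_right).2.2]
    exact ⟨congrArg JordanDecomposition.posPart h, congrArg JordanDecomposition.negPart h⟩
  exact Prod.ext ((Measure.ext_iff_of_iUnion_eq_univ hAunion).2 fun n => (key n).1)
    ((Measure.ext_iff_of_iUnion_eq_univ hAunion).2 fun n => (key n).2)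

/-- Given an increasing exhaustion `(A n)` of `Y` and a real-valued set function `ν`
whose restriction to the measurable subsets of each `A n` is a finite signed (countably
additive Borel) measure, there exists a unique pair of mutually singular σ-finite
positive measures `(μ⁺, μ⁻)` with `ν B = μ⁺ B - μ⁻ B` on every measurable `B` contained
in some `A n`. -/
theorem stmt_1 {Y : Type*} [MeasurableSpace Y]
    (A : ℕ → Set Y) (hAmeas : ∀ n, MeasurableSet (A n)) (hAmono : Monotone A)
    (hAunion : ⋃ n, A n = Set.univ)
    (ν : Set Y → ℝ)
    (hν : ∀ n, ∃ s : SignedMeasure Y,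
      ∀ B : Set Y, MeasurableSet B → B ⊆ A n → ν B = s B) :
    ∃! p : Measure Y × Measure Y,
      SigmaFinite p.1 ∧ SigmaFinite p.2 ∧ p.1 ⟂ₘ p.2 ∧
      ∀ n, ∀ B : Set Y, MeasurableSet B → B ⊆ A n →
        p.1 B < ⊤ ∧ p.2 B < ⊤ ∧ ν B = (p.1 B).toReal - (p.2 B).toReal := by
  choose s hs using hν
  have hD : ∀ k, MeasurableSet (disjointed A k) := fun k => MeasurableSet.disjointed hAmeas k
  have hempty : ∀ n, ∀ B ⊆ A n, ∀ k ∉ Finset.range (n + 1), B ∩ disjointed A k = ∅ := by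
    intro n B hB k hk
    rw [Finset.mem_range, not_lt] at hk
    ext x
    simp only [Set.mem_inter_iff, Set.mem_empty_iff_false, iff_false, not_and]
    intro hx hxk
    have hx' : x ∈ A k \ A (k - 1) := by
      rw [← Nat.sub_add_cancel (show 1 ≤ k by omega)] at hxk
      rw [hAmono.disjointed_add_one] at hxk
      rwa [Nat.sub_add_cancel (show 1 ≤ k by omega)] at hxk
    exact hx'.2 (hAmono (by omega : n ≤ k - 1) (hB hx))
  have hsum : ∀ (m : ℕ → Measure Y) (n : ℕ) (B : Set Y), MeasurableSet B → B ⊆ A n →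
      Measure.sum (fun k => (m k).restrict (disjointed A k)) B
      = ∑ k ∈ Finset.range (n + 1), m k (B ∩ disjointed A k) := by
    intro m n B hB hBA
    rw [Measure.sum_apply _ hB, tsum_eq_sum (s := Finset.range (n + 1))]
    · exact Finset.sum_congr rfl fun k _ => Measure.restrict_apply hB
    · intro k hk
      rw [Measure.restrict_apply hB, hempty n B hBA k hk, measure_empty]
  have hsν : ∀ n, ∀ B : Set Y, MeasurableSet B → B ⊆ A n →
      ν B = ∑ k ∈ Finset.range (n + 1), s k (B ∩ disjointed A k) := by
    intro n B hB hBA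
    have hU : B = ⋃ k, B ∩ disjointed A k := by
      rw [← Set.inter_iUnion, iUnion_disjointed, hAunion, Set.inter_univ]
    rw [hs n B hB hBA]
    conv_lhs => rw [hU]
    rw [VectorMeasure.of_disjoint_iUnion (fun k => hB.inter (hD k))
      (fun i j hij => (disjoint_disjointed A hij).mono Set.inter_subset_right
        Set.inter_subset_right), tsum_eq_sum (s := Finset.range (n + 1))]
    · refine Finset.sum_congr rfl fun k _ => ?_
      rw [← hs n _ (hB.inter (hD k)) (Set.inter_subset_left.trans hBA),
        ← hs k _ (hB.inter (hD k)) (Set.inter_subset_right.trans (disjointed_subset A k))]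
    · intro k hk
      rw [hempty n B hBA k hk, VectorMeasure.empty]
  have hfin : ∀ (m : ℕ → Measure Y), (∀ k, IsFiniteMeasure (m k)) → ∀ (n : ℕ) (B : Set Y),
      MeasurableSet B → B ⊆ A n →
      Measure.sum (fun k => (m k).restrict (disjointed A k)) B < ⊤ := by
    intro m hm n B hB hBA
    rw [hsum m n B hB hBA]
    exact ENNReal.sum_lt_top.2 fun k _ => measure_lt_top _ _
  have hsf : ∀ (m : ℕ → Measure Y), (∀ k, IsFiniteMeasure (m k)) →
      SigmaFinite (Measure.sum (fun k => (m k).restrict (disjointed A k))) := fun m hm =>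
    ⟨⟨{ set := A
        set_mem := fun _ => trivial
        finite := fun n => hfin m hm n _ (hAmeas n) subset_rfl
        spanning := hAunion }⟩⟩
  let mp : ℕ → Measure Y := fun k => (s k).toJordanDecomposition.posPart
  let mn : ℕ → Measure Y := fun k => (s k).toJordanDecomposition.negPart
  have hmp : ∀ k, IsFiniteMeasure (mp k) := fun k =>
    (s k).toJordanDecomposition.posPart_finite
  have hmn : ∀ k, IsFiniteMeasure (mn k) := fun k =>
    (s k).toJordanDecomposition.negPart_finite
  refine existsUnique_of_exists_of_unique ⟨(Measure.sum (fun k => (mp k).restrict (disjointed A k)),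
    Measure.sum (fun k => (mn k).restrict (disjointed A k))), hsf mp hmp, hsf mn hmn, ?_, ?_⟩ ?_
  · rw [Measure.MutuallySingular.sum_left]
    intro i
    rw [Measure.MutuallySingular.sum_right]
    intro k
    by_cases h : i = k
    · subst h
      exact (s i).toJordanDecomposition.mutuallySingular.mono
        Measure.restrict_le_self Measure.restrict_le_self
    · refine ⟨(disjointed A i)ᶜ, (hD i).compl, ?_, ?_⟩
      · rw [Measure.restrict_apply (hD i).compl, Set.compl_inter_self, measure_empty]
      · rw [compl_compl, Measure.restrict_apply (hD i),
          (disjoint_disjointed A h).inter_eq, measure_empty]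
  · intro n B hB hBA
    refine ⟨hfin mp hmp n B hB hBA, hfin mn hmn n B hB hBA, ?_⟩
    simp only
    rw [hsum mp n B hB hBA, hsum mn n B hB hBA, hsν n B hB hBA,
      ENNReal.toReal_sum (fun k _ => measure_ne_top _ _),
      ENNReal.toReal_sum (fun k _ => measure_ne_top _ _), ← Finset.sum_sub_distrib]
    refine Finset.sum_congr rfl fun k _ => ?_
    exact (s k).apply_eq_posPart_real_sub_negPart_real (hB.inter (hD k))
  · rintro p q ⟨-, -, hp, hp'⟩ ⟨-, -, hq, hq'⟩
    exact aux_unique A hAmeas hAunion ν p q hp hq hp' hq'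
end

section
/- Let Y be a measurable space, let (μₙ)ₙ and μ be finite positive Borel measures on Y with μₙ converging setwise to μ, and let (φₙ)ₙ be a sequence of measurable real-valued functions with supₙ sup_{x} |φₙ(x)| < ∞ and φₙ(x) → φ(x) for every x ∈ Y, where φ is a bounded measurable function. Then ∫_Y φₙ dμₙ → ∫_Y φ dμ as n → ∞. -/
open MeasureTheory Filter Topology
open scoped ENNReal

theorem aux_fixed {Y : Type*} [MeasurableSpace Y]
    (μn : ℕ → Measure Y) (μ : Measure Y)
    [∀ n, IsFiniteMeasure (μn n)] [IsFiniteMeasure μ]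
    (hset : ∀ B : Set Y, MeasurableSet B →
      Tendsto (fun n => (μn n).real B) atTop (𝓝 (μ.real B)))
    (f : Y → ℝ) (hf : Measurable f) (M : ℝ) (h0 : ∀ x, 0 ≤ f x) (hM : ∀ x, f x ≤ M) :
    Tendsto (fun n => ∫ x, f x ∂(μn n)) atTop (𝓝 (∫ x, f x ∂μ)) := by
  have hint : ∀ (ν : Measure Y) [IsFiniteMeasure ν], Integrable f ν := fun ν _ =>
    Integrable.of_bound hf.aestronglyMeasurable M
      (ae_of_all _ fun x => by rw [Real.norm_eq_abs, abs_of_nonneg (h0 x)]; exact hM x)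
  have key : ∀ (ν : Measure Y) [IsFiniteMeasure ν],
      ∫ x, f x ∂ν = ∫ t in Set.Ioc 0 M, ν.real {a | t ≤ f a} := fun ν _ =>
    (hint ν).integral_eq_integral_Ioc_meas_le (ae_of_all _ h0) (ae_of_all _ hM)
  simp_rw [key]
  have hu := (hset Set.univ MeasurableSet.univ).eventually (gt_mem_nhds (lt_add_one _))
  refine tendsto_integral_filter_of_dominated_convergence (fun _ => μ.real Set.univ + 1) ?_ ?_ ?_ ?_
  · refine Eventually.of_forall fun n => ?_
    refine (Antitone.measurable ?_).aestronglyMeasurable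
    intro a b hab
    exact measureReal_mono (fun x (hx : b ≤ f x) => hab.trans hx)
  · filter_upwards [hu] with n hn
    refine ae_of_all _ fun t => ?_
    rw [Real.norm_eq_abs, abs_of_nonneg measureReal_nonneg]
    exact (measureReal_mono (Set.subset_univ _)).trans hn.le
  · exact integrable_const _
  · exact ae_of_all _ fun t => hset _ (measurableSet_le measurable_const hf)

/-- If finite measures `μn` converge setwise to `μ`, and `(φn)` are measurable functions,
uniformly bounded, converging pointwise everywhere to a bounded measurable `φ`, then
`∫ φn dμn → ∫ φ dμ`. -/
theorem stmt_2 {Y : Type*} [MeasurableSpace Y]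
    (μn : ℕ → Measure Y) (μ : Measure Y)
    [∀ n, IsFiniteMeasure (μn n)] [IsFiniteMeasure μ]
    (hset : ∀ B : Set Y, MeasurableSet B →
      Tendsto (fun n => μn n B) atTop (𝓝 (μ B)))
    (φn : ℕ → Y → ℝ) (φ : Y → ℝ)
    (hφnmeas : ∀ n, Measurable (φn n))
    (hφmeas : Measurable φ)
    (hunifbdd : ∃ C : ℝ, ∀ n x, |φn n x| ≤ C)
    (hφbdd : ∃ C : ℝ, ∀ x, |φ x| ≤ C)
    (hptw : ∀ x, Tendsto (fun n => φn n x) atTop (𝓝 (φ x))) :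
    Tendsto (fun n => ∫ x, φn n x ∂(μn n)) atTop (𝓝 (∫ x, φ x ∂μ)) := by
  have hreal : ∀ B : Set Y, MeasurableSet B →
      Tendsto (fun n => (μn n).real B) atTop (𝓝 (μ.real B)) := fun B hB =>
    (ENNReal.tendsto_toReal (measure_ne_top μ B)).comp (hset B hB)
  obtain ⟨C, hC⟩ := hunifbdd
  obtain ⟨D, hD⟩ := hφbdd
  have hint : ∀ (ν : Measure Y) [IsFiniteMeasure ν], Integrable φ ν := fun ν _ =>
    Integrable.of_bound hφmeas.aestronglyMeasurable D (ae_of_all _ hD)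
  have hintn : ∀ n (ν : Measure Y) [IsFiniteMeasure ν], Integrable (φn n) ν := fun n ν _ =>
    Integrable.of_bound (hφnmeas n).aestronglyMeasurable C (ae_of_all _ (hC n))
  have h1 : Tendsto (fun n => ∫ x, φ x ∂(μn n)) atTop (𝓝 (∫ x, φ x ∂μ)) := by
    have h := aux_fixed μn μ hreal (fun x => φ x + D) (hφmeas.add_const D) (D + D)
      (fun x => by linarith [(abs_le.1 (hD x)).1]) (fun x => by linarith [(abs_le.1 (hD x)).2])
    have h' := h.sub ((hreal Set.univ MeasurableSet.univ).mul_const D)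
    have e : ∀ (ν : Measure Y) [IsFiniteMeasure ν],
        ∫ x, (φ x + D) ∂ν - ν.real Set.univ * D = ∫ x, φ x ∂ν := fun ν _ => by
      rw [integral_add (hint ν) (integrable_const D), integral_const, smul_eq_mul]
      ring
    simpa only [e] using h'
  have h2 : Tendsto (fun n => ∫ x, φn n x ∂(μn n) - ∫ x, φ x ∂(μn n)) atTop (𝓝 0) := by
    rw [Metric.tendsto_nhds]
    intro ε hε
    set K := |C| + |D| with hK
    have hK0 : 0 ≤ K := by positivity
    set m := μ.real Set.univ with hm
    have hm0 : 0 ≤ m := measureReal_nonneg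
    set η := ε / (m + K + 1) with hη
    have hη0 : 0 < η := by positivity
    have hηε : η * (m + K + 1) = ε := by rw [hη]; field_simp
    obtain ⟨t, htm, htμ, hunif⟩ := tendstoUniformlyOn_of_ae_tendsto' (μ := μ) (f := φn) (g := φ)
      (fun n => (hφnmeas n).stronglyMeasurable) hφmeas.stronglyMeasurable
      (ae_of_all _ hptw) hη0
    have htr : μ.real t ≤ η := ENNReal.toReal_le_of_le_ofReal hη0.le htμ
    have hlim := ((hreal Set.univ MeasurableSet.univ).const_mul η).add ((hreal t htm).const_mul K)
    have hlt : η * μ.real Set.univ + K * μ.real t < ε := by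
      have := mul_le_mul_of_nonneg_left htr hK0
      rw [← hm]
      nlinarith
    filter_upwards [hlim.eventually (gt_mem_nhds hlt),
      Metric.tendstoUniformlyOn_iff.1 hunif η hη0] with n hn hun
    rw [dist_zero_right, ← integral_sub (hintn n _) (hint _)]
    refine lt_of_le_of_lt ?_ hn
    have hind : Integrable (t.indicator fun _ => K) (μn n) := (integrable_const K).indicator htm
    have e : ∫ x, (η + t.indicator (fun _ => K) x) ∂(μn n)
        = η * (μn n).real Set.univ + K * (μn n).real t := by
      rw [integral_add (integrable_const η) hind, integral_const, integral_indicator_const _ htm,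
        smul_eq_mul, smul_eq_mul]
      ring
    rw [← e]
    refine norm_integral_le_of_norm_le ((integrable_const η).add hind) (ae_of_all _ fun x => ?_)
    by_cases hx : x ∈ t
    · rw [Set.indicator_of_mem hx]
      have a := norm_sub_le (φn n x) (φ x)
      have b := (hC n x).trans (le_abs_self C)
      have c := (hD x).trans (le_abs_self D)
      simp only [Real.norm_eq_abs] at *
      linarith
    · rw [Set.indicator_of_notMem hx, add_zero, ← dist_eq_norm, dist_comm]
      exact (hun x hx).le
  simpa using h2.add h1
end

section
/- Let Y be a measurable space, (μₙ)ₙ a sequence of σ-finite positive Borel measures on Y, and f : Y → [0,∞) a bounded measurable function with μₙ({x : f(x) = 0}) = 0 for every n. Suppose each f·μₙ (the measure with density f with respect to μₙ) is a finite measure and f·μₙ converges setwise to a finite measure ν. Then ν({x : f(x) = 0}) = 0, and, defining μ as the measure with density 1_{f>0}·f⁻¹ with respect to ν, the measure μ is σ-finite and for every k ≥ 1 and every measurable set B one has μₙ(B ∩ {f ≥ 1/k}) → μ(B ∩ {f ≥ 1/k}) as n → ∞. -/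
open MeasureTheory Filter Topology
open scoped ENNReal

theorem aux_tendsto {Y : Type*} [MeasurableSpace Y] (l : ℕ → Measure Y) (ν : Measure Y)
    [IsFiniteMeasure ν]
    (hset : ∀ B : Set Y, MeasurableSet B → Tendsto (fun n => l n B) atTop (𝓝 (ν B)))
    (g : Y → ℝ) (hg : Measurable g) (h0 : ∀ x, 0 ≤ g x) (M : ℝ) (hM : ∀ x, g x ≤ M) :
    Tendsto (fun n => ∫⁻ x, ENNReal.ofReal (g x) ∂(l n)) atTop
      (𝓝 (∫⁻ x, ENNReal.ofReal (g x) ∂ν)) := by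
  have key : ∀ m : Measure Y, ∫⁻ x, ENNReal.ofReal (g x) ∂m
      = ∫⁻ t in Set.Ioi (0:ℝ), m {x | t < g x} := fun m =>
    lintegral_eq_lintegral_meas_lt m (Eventually.of_forall h0) hg.aemeasurable
  simp only [key]
  refine tendsto_lintegral_filter_of_dominated_convergence
    (Set.indicator (Set.Iic M) (fun _ => ν Set.univ + 1)) ?_ ?_ ?_ ?_
  · refine Eventually.of_forall fun n => ?_
    refine Antitone.measurable fun s t hst => measure_mono fun x hx => ?_
    exact lt_of_le_of_lt hst hx
  · have h1 : ν Set.univ < ν Set.univ + 1 :=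
      ENNReal.lt_add_right (measure_ne_top _ _) one_ne_zero
    filter_upwards [(hset _ MeasurableSet.univ).eventually (gt_mem_nhds h1)] with n hn
    refine Eventually.of_forall fun t => ?_
    by_cases ht : t ≤ M
    · rw [Set.indicator_of_mem (by exact ht)]
      exact (measure_mono (Set.subset_univ _)).trans hn.le
    · have : {x | t < g x} = ∅ := by
        ext x
        have := hM x
        simp
        linarith
      simp [this]
  · rw [lintegral_indicator measurableSet_Iic, lintegral_const,
      Measure.restrict_restrict measurableSet_Iic]
    refine ENNReal.mul_ne_top (by simp) ?_
    rw [Measure.restrict_apply_univ, Set.inter_comm, Set.Ioi_inter_Iic]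
    simp
  · exact Eventually.of_forall fun t => hset _ (measurableSet_lt measurable_const hg)

/-- If `f ≥ 0` is bounded measurable, strictly positive `μn`-a.e., the measures `f·μn`
are finite and converge setwise to a finite measure `ν`, then `ν {f = 0} = 0`, the
measure `μ = 1_{f>0}·f⁻¹·ν` is σ-finite, and `μn (B ∩ {f ≥ 1/k}) → μ (B ∩ {f ≥ 1/k})`
for every `k ≥ 1` and every measurable `B`. -/
theorem stmt_3 {Y : Type*} [MeasurableSpace Y]
    (μn : ℕ → Measure Y) [∀ n, SigmaFinite (μn n)]
    (f : Y → ℝ) (hfmeas : Measurable f) (hfnonneg : ∀ x, 0 ≤ f x)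
    (hfbdd : ∃ C : ℝ, ∀ x, f x ≤ C)
    (hnull : ∀ n, μn n {x | f x = 0} = 0)
    (hfin : ∀ n, IsFiniteMeasure ((μn n).withDensity fun x => ENNReal.ofReal (f x)))
    (ν : Measure Y) [IsFiniteMeasure ν]
    (hset : ∀ B : Set Y, MeasurableSet B →
      Tendsto (fun n => (μn n).withDensity (fun x => ENNReal.ofReal (f x)) B)
        atTop (𝓝 (ν B))) :
    ν {x | f x = 0} = 0 ∧
    SigmaFinite (ν.withDensity fun x => if 0 < f x then (ENNReal.ofReal (f x))⁻¹ else 0) ∧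
    ∀ k : ℕ, 1 ≤ k → ∀ B : Set Y, MeasurableSet B →
      Tendsto (fun n => μn n (B ∩ {x | 1 / (k : ℝ) ≤ f x})) atTop
        (𝓝 ((ν.withDensity fun x => if 0 < f x then (ENNReal.ofReal (f x))⁻¹ else 0)
            (B ∩ {x | 1 / (k : ℝ) ≤ f x}))) := by
  have hfm : Measurable fun x => ENNReal.ofReal (f x) := hfmeas.ennreal_ofReal
  have hdm : Measurable fun x => if 0 < f x then (ENNReal.ofReal (f x))⁻¹ else 0 :=
    Measurable.ite (measurableSet_lt measurable_const hfmeas) hfm.inv measurable_const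
  refine ⟨?_, ?_, ?_⟩
  · have h := hset {x | f x = 0} (hfmeas (measurableSet_singleton 0))
    have h2 : ∀ n, (μn n).withDensity (fun x => ENNReal.ofReal (f x)) {x | f x = 0} = 0 :=
      fun n => withDensity_absolutelyContinuous _ _ (hnull n)
    simp only [h2] at h
    exact (tendsto_nhds_unique h tendsto_const_nhds)
  · refine SigmaFinite.withDensity_of_ne_top (Eventually.of_forall fun x => ?_)
    split_ifs with h
    · simp [h]
    · simp
  · intro k hk B hB
    have hk0 : (0:ℝ) < k := by exact_mod_cast hk
    have hA : MeasurableSet (B ∩ {x | 1 / (k : ℝ) ≤ f x}) :=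
      hB.inter (measurableSet_le measurable_const hfmeas)
    set A := B ∩ {x | 1 / (k : ℝ) ≤ f x} with hAdef
    have hAf : ∀ x ∈ A, 1 / (k:ℝ) ≤ f x := fun x hx => hx.2
    have hApos : ∀ x ∈ A, 0 < f x := fun x hx => lt_of_lt_of_le (by positivity) (hAf x hx)
    have hgm : Measurable (A.indicator fun x => (f x)⁻¹) := hfmeas.inv.indicator hA
    have h := aux_tendsto _ ν hset (A.indicator fun x => (f x)⁻¹) hgm
      (fun x => Set.indicator_nonneg (fun x _ => inv_nonneg.2 (hfnonneg x)) x) k (by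
        intro x
        by_cases hx : x ∈ A
        · rw [Set.indicator_of_mem hx]
          have := hAf x hx
          rw [one_div] at this
          exact inv_le_of_inv_le₀ hk0 this
        · rw [Set.indicator_of_notMem hx]
          exact hk0.le)
    have e1 : ∀ n, ∫⁻ x, ENNReal.ofReal (A.indicator (fun x => (f x)⁻¹) x)
        ∂((μn n).withDensity fun x => ENNReal.ofReal (f x)) = μn n A := by
      intro n
      rw [lintegral_withDensity_eq_lintegral_mul _ hfm hgm.ennreal_ofReal,
        ← lintegral_indicator_one hA]
      refine lintegral_congr fun x => ?_
      by_cases hx : x ∈ A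
      · have := hApos x hx
        simp only [Pi.mul_apply, Set.indicator_of_mem hx, Pi.one_apply]
        rw [← ENNReal.ofReal_mul this.le, mul_inv_cancel₀ this.ne', ENNReal.ofReal_one]
      · simp [hx]
    have e2 : ∫⁻ x, ENNReal.ofReal (A.indicator (fun x => (f x)⁻¹) x) ∂ν =
        (ν.withDensity fun x => if 0 < f x then (ENNReal.ofReal (f x))⁻¹ else 0) A := by
      rw [withDensity_apply _ hA, ← lintegral_indicator hA]
      refine lintegral_congr fun x => ?_
      by_cases hx : x ∈ A
      · have := hApos x hx
        simp only [Set.indicator_of_mem hx, if_pos this]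
        exact ENNReal.ofReal_inv_of_pos this
      · simp [hx]
    rw [e2] at h
    simpa only [e1] using h
end

section
/- Let Y be a measurable space, (μₙ)ₙ and μ σ-finite positive Borel measures on Y, and (A_k)_k an increasing sequence of measurable sets with ⋃_k A_k = Y such that for every k the restrictions μₙ⌞A_k (for all n) and μ⌞A_k are finite measures and μₙ⌞A_k converges setwise to μ⌞A_k as n → ∞. Then there exists a bounded measurable function f : Y → (0,∞), strictly positive everywhere, such that all the measures f·μₙ and f·μ are finite and f·μₙ converges setwise to f·μ. -/
open MeasureTheory Filter Topology
open scoped ENNReal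

/-- If σ-finite measures `μn` converge to `μ` σ-setwise along an increasing measurable
exhaustion `(A k)` on which all measures are finite, then there exists a bounded,
everywhere strictly positive measurable function `f` such that the measures `f·μn`
and `f·μ` are finite and `f·μn` converges setwise to `f·μ`. -/
theorem stmt_4 {Y : Type*} [MeasurableSpace Y]
    (μn : ℕ → Measure Y) (μ : Measure Y)
    [∀ n, SigmaFinite (μn n)] [SigmaFinite μ]
    (A : ℕ → Set Y) (hAmeas : ∀ k, MeasurableSet (A k)) (hAmono : Monotone A)
    (hAunion : ⋃ k, A k = Set.univ)
    (hfinn : ∀ k n, μn n (A k) < ⊤) (hfin : ∀ k, μ (A k) < ⊤)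
    (hset : ∀ k, ∀ B : Set Y, MeasurableSet B →
      Tendsto (fun n => μn n (B ∩ A k)) atTop (𝓝 (μ (B ∩ A k)))) :
    ∃ f : Y → ℝ, Measurable f ∧ (∀ x, 0 < f x) ∧ (∃ C : ℝ, ∀ x, f x ≤ C) ∧
      (∀ n, (μn n).withDensity (fun x => ENNReal.ofReal (f x)) Set.univ < ⊤) ∧
      (μ.withDensity (fun x => ENNReal.ofReal (f x)) Set.univ < ⊤) ∧
      (∀ B : Set Y, MeasurableSet B →
        Tendsto (fun n => (μn n).withDensity (fun x => ENNReal.ofReal (f x)) B)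
          atTop (𝓝 (μ.withDensity (fun x => ENNReal.ofReal (f x)) B))) := by
  have hM : ∀ k, ∃ M : NNReal, ∀ n, μn n (A k) ≤ M := by
    intro k
    have h := hset k Set.univ MeasurableSet.univ
    simp only [Set.univ_inter] at h
    have h2 := (ENNReal.tendsto_toReal (hfin k).ne).comp h
    obtain ⟨M, hM⟩ := h2.bddAbove_range
    refine ⟨M.toNNReal, fun n => ?_⟩
    have := hM ⟨n, rfl⟩
    simp only [Function.comp] at this
    rw [← ENNReal.ofReal_toReal (hfinn k n).ne]
    exact ENNReal.ofReal_le_ofReal this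
  choose M hM using hM
  have hM' : ∀ k, μ (A k) ≤ M k := by
    intro k
    have h := hset k Set.univ MeasurableSet.univ
    simp only [Set.univ_inter] at h
    exact le_of_tendsto' h (hM k)
  let e : ℕ → ℝ≥0∞ := fun k => 2⁻¹ ^ (k + 1)
  let w : ℕ → ℝ≥0∞ := fun k => e k * (1 + (M k : ℝ≥0∞))⁻¹
  have he : ∑' k, e k = 1 := by
    simp only [e]
    rw [ENNReal.tsum_geometric_add_one, ENNReal.one_sub_inv_two, inv_inv]
    exact ENNReal.inv_mul_cancel (by simp) (by simp)
  have hwe : ∀ k, w k ≤ e k := fun k => by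
    refine mul_le_of_le_one_right' ?_
    rw [ENNReal.inv_le_one]
    exact le_self_add
  have hwpos : ∀ k, 0 < w k := fun k => by
    refine ENNReal.mul_pos ?_ ?_
    · simp [e]
    · simp
  have hwM : ∀ k, ∀ a : ℝ≥0∞, a ≤ M k → w k * a ≤ e k := fun k a ha => by
    calc w k * a ≤ w k * (1 + M k) := by gcongr; exact ha.trans le_add_self
      _ = e k * ((1 + (M k : ℝ≥0∞))⁻¹ * (1 + M k)) := mul_assoc _ _ _
      _ ≤ e k * 1 := by gcongr; exact ENNReal.inv_mul_le_one _
      _ = e k := mul_one _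
  let g : Y → ℝ≥0∞ := fun x => ∑' k, (A k).indicator (fun _ => w k) x
  have hgm : Measurable g :=
    Measurable.ennreal_tsum fun k => measurable_const.indicator (hAmeas k)
  have hg1 : ∀ x, g x ≤ 1 := fun x => by
    rw [← he]
    refine ENNReal.tsum_le_tsum fun k => ?_
    exact (Set.indicator_le_self' (fun _ _ => zero_le) x).trans (hwe k)
  have hgtop : ∀ x, g x ≠ ⊤ := fun x => ((hg1 x).trans_lt ENNReal.one_lt_top).ne
  have hg0 : ∀ x, g x ≠ 0 := fun x => by
    have hx : x ∈ ⋃ k, A k := by rw [hAunion]; trivial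
    obtain ⟨k, hk⟩ := Set.mem_iUnion.1 hx
    have h1 : w k ≤ g x := by
      have := ENNReal.le_tsum (f := fun k => (A k).indicator (fun _ => w k) x) k
      simpa [hk, g] using this
    exact ((hwpos k).trans_le h1).ne'
  have hfg : (fun x => ENNReal.ofReal ((g x).toReal)) = g :=
    funext fun x => ENNReal.ofReal_toReal (hgtop x)
  have hwd : ∀ ν : Measure Y, ∀ B, MeasurableSet B →
      ν.withDensity g B = ∑' k, w k * ν (B ∩ A k) := by
    intro ν B hB
    rw [withDensity_apply _ hB,
      lintegral_tsum fun k => (measurable_const.indicator (hAmeas k)).aemeasurable]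
    refine tsum_congr fun k => ?_
    rw [lintegral_indicator_const (hAmeas k), Measure.restrict_apply (hAmeas k), Set.inter_comm]
  have hfinite : ∀ ν : Measure Y, (∀ k, ν (A k) ≤ M k) → ν.withDensity g Set.univ < ⊤ := by
    intro ν hν
    rw [hwd ν _ MeasurableSet.univ]
    refine lt_of_le_of_lt (ENNReal.tsum_le_tsum fun k => hwM k _ ?_) (he ▸ ENNReal.one_lt_top)
    rw [Set.univ_inter]; exact hν k
  refine ⟨fun x => (g x).toReal, hgm.ennreal_toReal,
    fun x => ENNReal.toReal_pos (hg0 x) (hgtop x), ⟨1, fun x => ?_⟩, ?_, ?_, ?_⟩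
  · exact ENNReal.toReal_le_of_le_ofReal zero_le_one (by simpa using hg1 x)
  · intro n; rw [hfg]; exact hfinite _ fun k => hM k n
  · rw [hfg]; exact hfinite _ hM'
  · intro B hB
    rw [hfg]
    simp only [hwd _ B hB]
    simp only [← lintegral_count]
    refine tendsto_lintegral_of_dominated_convergence e (fun n => measurable_from_top)
      (fun n => Eventually.of_forall fun k => hwM k _ ?_) ?_ (Eventually.of_forall fun k => ?_)
    · exact (measure_mono Set.inter_subset_right).trans (hM k n)
    · rw [lintegral_count, he]; exact ENNReal.one_ne_top
    · refine ENNReal.Tendsto.const_mul (hset k B hB) (Or.inr ?_)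
      refine ((hwe k).trans_lt ?_).ne
      exact ((ENNReal.le_tsum k).trans_eq he).trans_lt ENNReal.one_lt_top
end

section
/- Let Y be a measurable space and Υ : [0,∞) → [0,∞] a proper, convex, lower semicontinuous function, with recession constant Υ∞ := lim_{t→∞} Υ(t)/t ∈ [0,∞]. For σ-finite positive Borel measures μ, ν on Y, writing the Lebesgue decomposition μ = ρ·ν + μ⊥ with ρ the Radon–Nikodym density of the absolutely continuous part and μ⊥ ⊥ ν, define F(μ|ν) := ∫_Y Υ(ρ) dν + Υ∞·μ⊥(Y) (with the convention Υ∞·0 = 0). Let (μₙ)ₙ, (νₙ)ₙ, μ, ν be σ-finite positive Borel measures and (A_k)_k an increasing sequence of measurable sets with ⋃_k A_k = Y such that for every k all the restrictions μₙ⌞A_k, νₙ⌞A_k, μ⌞A_k, ν⌞A_k are finite and μₙ⌞A_k → μ⌞A_k and νₙ⌞A_k → ν⌞A_k setwise as n → ∞. Then F(μ|ν) ≤ liminf_{n→∞} F(μₙ|νₙ). -/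
open MeasureTheory Filter Topology
open scoped ENNReal NNReal

/-- The integral functional `F(μ|ν) = ∫ Υ(dμ/dν) dν + Υ∞·μ⊥(Y)` built from a proper,
convex, lower semicontinuous integrand `Υ` with recession constant `Υ∞`. -/
noncomputable def Ffun {Y : Type*} [MeasurableSpace Y]
    (Υ : ℝ≥0∞ → ℝ≥0∞) (Υinf : ℝ≥0∞) (μ ν : Measure Y) : ℝ≥0∞ :=
  (∫⁻ y, Υ (μ.rnDeriv ν y) ∂ν) + Υinf * (μ.singularPart ν) Set.univ

/-- affine minorant with split coefficients -/
def IsAffMin (Υ : ℝ≥0∞ → ℝ≥0∞) (p q r s : ℝ≥0) : Prop :=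
  ∀ t : ℝ≥0, (p : ℝ≥0∞) * t + r ≤ Υ t + (q * t + s)

lemma liminf_superadd (u v : ℕ → ℝ≥0∞) :
    liminf u atTop + liminf v atTop ≤ liminf (fun n => u n + v n) atTop := by
  rw [liminf_eq_iSup_iInf_of_nat, liminf_eq_iSup_iInf_of_nat, liminf_eq_iSup_iInf_of_nat,
    ENNReal.iSup_add_iSup_of_monotone]
  · refine iSup_mono fun n => ?_
    refine le_iInf₂ fun i hi => add_le_add (iInf₂_le i hi) (iInf₂_le i hi)
  · intro a b hab
    exact le_iInf₂ fun i hi => iInf₂_le i (hab.trans hi)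
  · intro a b hab
    exact le_iInf₂ fun i hi => iInf₂_le i (hab.trans hi)

lemma isMin_of_real (Υ : ℝ≥0∞ → ℝ≥0∞) (a b : ℝ)
    (h : ∀ t y : ℝ≥0, Υ t ≤ y → a * t + b ≤ y) (t₀ c : ℝ≥0) (hc : (c : ℝ) < a * t₀ + b) :
    ∃ p q r s : ℝ≥0, IsAffMin Υ p q r s ∧ c + (q * t₀ + s) < p * t₀ + r := by
  have ha : a = (a.toNNReal : ℝ) - ((-a).toNNReal : ℝ) := by
    rw [Real.coe_toNNReal', Real.coe_toNNReal']; grind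
  have hb : b = (b.toNNReal : ℝ) - ((-b).toNNReal : ℝ) := by
    rw [Real.coe_toNNReal', Real.coe_toNNReal']; grind
  refine ⟨a.toNNReal, (-a).toNNReal, b.toNNReal, (-b).toNNReal, ?_, ?_⟩
  · intro t
    by_cases ht : Υ t = ⊤
    · simp [ht]
    · lift Υ t to ℝ≥0 using ht with y hy
      have := h t y hy.ge
      norm_cast
      rw [← NNReal.coe_le_coe]
      push_cast
      rw [ha, hb] at this
      linarith
  · rw [← NNReal.coe_lt_coe]
    push_cast
    rw [ha, hb] at hc
    linarith

lemma exists_min (Υ : ℝ≥0∞ → ℝ≥0∞)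
    (hproper : ∃ a : ℝ≥0∞, a ≠ ⊤ ∧ Υ a ≠ ⊤)
    (hconv : ∀ a b : ℝ≥0∞, a ≠ ⊤ → b ≠ ⊤ → ∀ t : ℝ≥0∞, t ≤ 1 →
      Υ (t * a + (1 - t) * b) ≤ t * Υ a + (1 - t) * Υ b)
    (hlsc : LowerSemicontinuous Υ) (t₀ c : ℝ≥0) (hc : (c : ℝ≥0∞) < Υ t₀) :
    ∃ p q r s : ℝ≥0, IsAffMin Υ p q r s ∧ c + (q * t₀ + s) < p * t₀ + r := by
  let E : Set (ℝ × ℝ) := {z | 0 ≤ z.1 ∧ 0 ≤ z.2 ∧ Υ (ENNReal.ofReal z.1) ≤ ENNReal.ofReal z.2}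
  have hEc : IsClosed E := by
    have h1 : IsClosed {z : ℝ × ℝ | 0 ≤ z.1} := isClosed_le continuous_const continuous_fst
    have h2 : IsClosed {z : ℝ × ℝ | 0 ≤ z.2} := isClosed_le continuous_const continuous_snd
    have h3 : IsClosed {z : ℝ × ℝ | Υ (ENNReal.ofReal z.1) ≤ ENNReal.ofReal z.2} := by
      have := hlsc.isClosed_epigraph
      exact this.preimage (f := fun z : ℝ × ℝ => (ENNReal.ofReal z.1, ENNReal.ofReal z.2))
        ((ENNReal.continuous_ofReal.comp continuous_fst).prodMk (ENNReal.continuous_ofReal.comp continuous_snd))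
    exact h1.inter (h2.inter h3)
  have hEconv : Convex ℝ E := by
    rintro ⟨x, y⟩ ⟨hx, hy, hxy⟩ ⟨x', y'⟩ ⟨hx', hy', hxy'⟩ a b ha hb hab
    simp only at hx hy hxy hx' hy' hxy'
    refine ⟨?_, ?_, ?_⟩
    · simp only [Prod.fst_add, Prod.smul_fst, smul_eq_mul]; positivity
    · simp only [Prod.snd_add, Prod.smul_snd, smul_eq_mul]; positivity
    · simp only [Prod.fst_add, Prod.smul_fst, smul_eq_mul, Prod.snd_add, Prod.smul_snd]
      have hb' : ENNReal.ofReal b = 1 - ENNReal.ofReal a := by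
        rw [← ENNReal.ofReal_one, ← ENNReal.ofReal_sub _ ha]; congr 1; linarith
      have := hconv (ENNReal.ofReal x) (ENNReal.ofReal x') ENNReal.ofReal_ne_top
        ENNReal.ofReal_ne_top (ENNReal.ofReal a) (by rw [ENNReal.ofReal_le_one]; linarith)
      rw [← hb', ← ENNReal.ofReal_mul ha, ← ENNReal.ofReal_mul hb,
        ← ENNReal.ofReal_add (by positivity) (by positivity)] at this
      refine this.trans ?_
      rw [ENNReal.ofReal_add (by positivity) (by positivity), ENNReal.ofReal_mul ha,
        ENNReal.ofReal_mul hb]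
      gcongr
  have hnot : ((t₀ : ℝ), (c : ℝ)) ∉ E := by
    rintro ⟨-, -, h⟩
    simp only [ENNReal.ofReal_coe_nnreal] at h
    exact absurd hc (not_lt.2 h)
  obtain ⟨f, u, hfu, hE⟩ := geometric_hahn_banach_point_closed hEconv hEc hnot
  set α := f (1, 0)
  set β := f (0, 1)
  have hf : ∀ x y : ℝ, f (x, y) = α * x + β * y := by
    intro x y
    have : ((x, y) : ℝ × ℝ) = x • ((1 : ℝ), (0 : ℝ)) + y • ((0 : ℝ), (1 : ℝ)) := by simp
    rw [this, map_add, map_smul, map_smul, smul_eq_mul, smul_eq_mul]; ring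
  rw [hf] at hfu
  have hE' : ∀ t y : ℝ≥0, Υ t ≤ y → u < α * t + β * y := by
    intro t y h
    rw [← hf]
    exact hE _ ⟨t.2, y.2, by simpa using h⟩
  obtain ⟨a, ha, haΥ⟩ := hproper
  lift a to ℝ≥0 using ha
  lift Υ a to ℝ≥0 using haΥ with w hw
  have hβ : 0 ≤ β := by
    by_contra! hneg
    obtain ⟨N, hN⟩ := exists_nat_gt ((α * a + β * w - u) / (-β))
    have := hE' a (w + N) (by rw [← hw]; norm_cast; simp)
    push_cast at this
    rw [div_lt_iff₀ (by linarith)] at hN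
    nlinarith
  rcases hβ.eq_or_lt with h0 | hpos
  · rw [← h0] at hfu hE'
    have hd : 0 < u - α * t₀ := by linarith
    obtain ⟨N, hN⟩ := exists_nat_gt ((c : ℝ) / (u - α * t₀))
    rw [div_lt_iff₀ hd] at hN
    refine isMin_of_real Υ (-N * α) (N * u) ?_ t₀ c (by linarith)
    intro t y h
    have := hE' t y h
    have hy := y.2
    have hN0 : (0 : ℝ) ≤ N := by positivity
    have := mul_nonneg hN0 (show 0 ≤ α * t - u by linarith)
    have : (0 : ℝ) ≤ y := hy
    linarith
  · refine isMin_of_real Υ (-α / β) (u / β) ?_ t₀ c ?_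
    · intro t y h
      have := hE' t y h
      rw [div_mul_eq_mul_div, ← add_div, div_le_iff₀ hpos]; linarith
    · rw [div_mul_eq_mul_div, ← add_div, lt_div_iff₀ hpos]; linarith

lemma exists_slope (Υ : ℝ≥0∞ → ℝ≥0∞) (Υinf : ℝ≥0∞)
    (hrec : Tendsto (fun t : ℝ≥0 => Υ (t : ℝ≥0∞) / (t : ℝ≥0∞)) atTop (𝓝 Υinf))
    (c : ℝ≥0) (hc : (c : ℝ≥0∞) < Υinf) : ∃ s, IsAffMin Υ c 0 0 s := by
  have h := (hrec.eventually (lt_mem_nhds hc)).and (eventually_gt_atTop 0)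
  obtain ⟨T, hT⟩ := eventually_atTop.1 h
  refine ⟨c * T, fun t => ?_⟩
  rcases le_total T t with h | h
  · obtain ⟨h1, h2⟩ := hT t h
    have := (ENNReal.le_div_iff_mul_le (Or.inl (by simpa using h2.ne')) (Or.inl (by simp))).1 h1.le
    simp only [ENNReal.coe_zero, add_zero]
    exact this.trans le_self_add
  · simp only [ENNReal.coe_zero, add_zero, zero_mul, zero_add]
    refine le_trans ?_ le_add_self
    norm_cast
    gcongr

lemma slope_le (Υ : ℝ≥0∞ → ℝ≥0∞) (Υinf : ℝ≥0∞)
    (hrec : Tendsto (fun t : ℝ≥0 => Υ (t : ℝ≥0∞) / (t : ℝ≥0∞)) atTop (𝓝 Υinf))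
    {p q r s : ℝ≥0} (h : IsAffMin Υ p q r s) : (p : ℝ≥0∞) ≤ Υinf + q := by
  have hs : Tendsto (fun t : ℝ≥0 => (s : ℝ≥0∞) / t) atTop (𝓝 0) := by
    have h2 : Tendsto (fun t : ℝ≥0 => (t : ℝ≥0∞)) atTop (𝓝 ⊤) :=
      ENNReal.tendsto_coe_nhds_top.2 tendsto_id
    have h3 := ENNReal.Tendsto.const_div (a := (s : ℝ≥0∞)) h2 (Or.inr ENNReal.coe_ne_top)
    simpa using h3
  have h1 := (hrec.add_const (q : ℝ≥0∞)).add hs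
  rw [add_zero] at h1
  refine ge_of_tendsto h1 ?_
  filter_upwards [eventually_gt_atTop 0] with t ht
  have ht' : (t : ℝ≥0∞) ≠ 0 := by simpa using ht.ne'
  calc (p : ℝ≥0∞) = p * t / t := (ENNReal.mul_div_cancel_right ht' (by simp)).symm
    _ ≤ (Υ t + (q * t + s)) / t := by
      gcongr; exact le_self_add.trans (h t)
    _ = _ := by
      rw [ENNReal.add_div, ENNReal.add_div, ENNReal.mul_div_cancel_right ht' (by simp), add_assoc]

lemma exists_countable_min (Υ : ℝ≥0∞ → ℝ≥0∞)
    (hproper : ∃ a : ℝ≥0∞, a ≠ ⊤ ∧ Υ a ≠ ⊤)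
    (hconv : ∀ a b : ℝ≥0∞, a ≠ ⊤ → b ≠ ⊤ → ∀ t : ℝ≥0∞, t ≤ 1 →
      Υ (t * a + (1 - t) * b) ≤ t * Υ a + (1 - t) * Υ b)
    (hlsc : LowerSemicontinuous Υ) :
    ∃ p q r s : ℕ → ℝ≥0, (∀ i, IsAffMin Υ (p i) (q i) (r i) (s i)) ∧
      ∀ t : ℝ≥0, Υ t = ⨆ i, (((p i : ℝ≥0∞) * t + r i) - (q i * t + s i)) := by
  let I := {z : ℝ≥0 × ℝ≥0 × ℝ≥0 × ℝ≥0 // IsAffMin Υ z.1 z.2.1 z.2.2.1 z.2.2.2}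
  let L : I → ℝ≥0 → ℝ≥0∞ := fun z t =>
    (((z.1.1 * t + z.1.2.2.1) - (z.1.2.1 * t + z.1.2.2.2) : ℝ≥0) : ℝ≥0∞)
  have hlub : IsLUB (Set.range L) (fun t : ℝ≥0 => Υ t) := by
    rw [isLUB_pi]
    intro t
    constructor
    · rintro _ ⟨_, ⟨z, rfl⟩, rfl⟩
      simp only [L, Function.eval]
      push_cast
      exact tsub_le_iff_right.2 (z.2 t)
    · intro b hb
      refine ENNReal.le_of_forall_nnreal_lt fun c hc => ?_
      obtain ⟨p, q, r, s, hm, hlt⟩ := exists_min Υ hproper hconv hlsc t c hc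
      refine le_trans ?_ (hb ⟨_, ⟨⟨(p, q, r, s), hm⟩, rfl⟩, rfl⟩)
      simp only [L, Function.eval]
      norm_cast
      exact le_tsub_of_add_le_right hlt.le
  obtain ⟨F', hsub, hcount, hl⟩ := exists_countable_lowerSemicontinuous_isLUB (by
    rintro _ ⟨z, rfl⟩
    refine Continuous.lowerSemicontinuous ?_
    simp only [L]
    fun_prop) hlub
  have h0 : IsAffMin Υ 0 0 0 0 := fun t => by simp
  let z0 : I := ⟨(0, 0, 0, 0), h0⟩
  obtain ⟨f, hf⟩ := (hcount.insert (L z0)).exists_eq_range (Set.insert_nonempty _ _)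
  have hz : ∀ i, ∃ z : I, L z = f i := by
    intro i
    have : f i ∈ insert (L z0) F' := hf ▸ Set.mem_range_self i
    rcases this with h | h
    · exact ⟨z0, h.symm⟩
    · exact hsub h
  choose z hz using hz
  refine ⟨fun i => (z i).1.1, fun i => (z i).1.2.1, fun i => (z i).1.2.2.1,
    fun i => (z i).1.2.2.2, fun i => (z i).2, fun t => ?_⟩
  apply le_antisymm
  · rw [isLUB_pi] at hl
    refine (hl t).2 ?_
    rintro _ ⟨g, hg, rfl⟩
    have : g ∈ insert (L z0) F' := Or.inr hg
    rw [hf] at this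
    obtain ⟨i, rfl⟩ := this
    refine le_trans ?_ (le_iSup _ i)
    rw [← hz]
    simp [L, Function.eval]
  · exact iSup_le fun i => tsub_le_iff_right.2 ((z i).2 t)

/-- localized functional -/
noncomputable def FBfun {Y : Type*} [MeasurableSpace Y]
    (Υ : ℝ≥0∞ → ℝ≥0∞) (Υinf : ℝ≥0∞) (μ ν : Measure Y) (B : Set Y) : ℝ≥0∞ :=
  (∫⁻ y in B, Υ (μ.rnDeriv ν y) ∂ν) + Υinf * (μ.singularPart ν) B

lemma measure_decomp {Y : Type*} [MeasurableSpace Y] (μ ν : Measure Y) [SigmaFinite μ]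
    [SigmaFinite ν] {B : Set Y} (hB : MeasurableSet B) :
    μ B = ∫⁻ y in B, μ.rnDeriv ν y ∂ν + μ.singularPart ν B := by
  conv_lhs => rw [← Measure.rnDeriv_add_singularPart μ ν]
  rw [Measure.add_apply, withDensity_apply _ hB]

lemma lintegral_aff {Y : Type*} [MeasurableSpace Y] (ν : Measure Y) (f : Y → ℝ≥0∞)
    (hf : Measurable f) (p r : ℝ≥0) (B : Set Y) :
    ∫⁻ y in B, (p * f y + r) ∂ν = p * ∫⁻ y in B, f y ∂ν + r * ν B := by
  rw [lintegral_add_right _ measurable_const, lintegral_const_mul _ hf, setLIntegral_const]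

lemma FB_lower {Y : Type*} [MeasurableSpace Y]
    (Υ : ℝ≥0∞ → ℝ≥0∞) (Υinf : ℝ≥0∞)
    (hrec : Tendsto (fun t : ℝ≥0 => Υ (t : ℝ≥0∞) / (t : ℝ≥0∞)) atTop (𝓝 Υinf))
    (μ ν : Measure Y) [SigmaFinite μ] [SigmaFinite ν]
    {p q r s : ℝ≥0} (h : IsAffMin Υ p q r s) {B : Set Y} (hB : MeasurableSet B) :
    p * μ B + r * ν B ≤ FBfun Υ Υinf μ ν B + (q * μ B + s * ν B) := by
  have hm := Measure.measurable_rnDeriv μ ν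
  have h1 : ∫⁻ y in B, (p * μ.rnDeriv ν y + r) ∂ν ≤
      ∫⁻ y in B, Υ (μ.rnDeriv ν y) ∂ν + ∫⁻ y in B, (q * μ.rnDeriv ν y + s) ∂ν := by
    rw [← lintegral_add_right _ (by fun_prop)]
    refine lintegral_mono_ae ?_
    filter_upwards [ae_restrict_of_ae (Measure.rnDeriv_lt_top μ ν)] with y hy
    have := h (μ.rnDeriv ν y).toNNReal
    rwa [ENNReal.coe_toNNReal hy.ne] at this
  rw [lintegral_aff _ _ hm, lintegral_aff _ _ hm] at h1
  have h2 : p * μ.singularPart ν B ≤ (Υinf + q) * μ.singularPart ν B := by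
    gcongr; exact slope_le Υ Υinf hrec h
  rw [measure_decomp μ ν hB, FBfun]
  calc _ = (p * ∫⁻ y in B, μ.rnDeriv ν y ∂ν + r * ν B) + p * μ.singularPart ν B := by ring
    _ ≤ _ := add_le_add h1 h2
    _ = _ := by ring

lemma FB_add {Y : Type*} [MeasurableSpace Y]
    (Υ : ℝ≥0∞ → ℝ≥0∞) (Υinf : ℝ≥0∞) (μ ν : Measure Y) {B C : Set Y}
    (hC : MeasurableSet C) (hd : Disjoint B C) :
    FBfun Υ Υinf μ ν (B ∪ C) = FBfun Υ Υinf μ ν B + FBfun Υ Υinf μ ν C := by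
  simp only [FBfun]
  rw [lintegral_union hC hd, measure_union hd hC]
  ring

lemma FB_mono {Y : Type*} [MeasurableSpace Y]
    (Υ : ℝ≥0∞ → ℝ≥0∞) (Υinf : ℝ≥0∞) (μ ν : Measure Y) {B C : Set Y} (h : B ⊆ C) :
    FBfun Υ Υinf μ ν B ≤ FBfun Υ Υinf μ ν C := by
  simp only [FBfun]
  gcongr

lemma lintegral_max_le {Y : Type*} [MeasurableSpace Y] (ν : Measure Y) (T : Set Y → ℝ≥0∞)
    (hT : ∀ B C, MeasurableSet C → Disjoint B C → T B + T C ≤ T (B ∪ C)) (S : Set Y)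
    (h l : Y → ℝ≥0∞) (hh : Measurable h) (hl : Measurable l)
    (h1 : ∀ B ⊆ S, MeasurableSet B → ∫⁻ y in B, h y ∂ν ≤ T B)
    (h2 : ∀ B ⊆ S, MeasurableSet B → ∫⁻ y in B, l y ∂ν ≤ T B)
    (B : Set Y) (hBS : B ⊆ S) (hB : MeasurableSet B) :
    ∫⁻ y in B, (h y ⊔ l y) ∂ν ≤ T B := by
  have hD : MeasurableSet {y | h y ≤ l y} := measurableSet_le hh hl
  rw [← lintegral_inter_add_sdiff _ B hD]
  have e1 : ∫⁻ y in B ∩ {y | h y ≤ l y}, (h y ⊔ l y) ∂ν = ∫⁻ y in B ∩ {y | h y ≤ l y}, l y ∂ν :=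
    setLIntegral_congr_fun (hB.inter hD) fun y hy => sup_eq_right.2 hy.2
  have e2 : ∫⁻ y in B \ {y | h y ≤ l y}, (h y ⊔ l y) ∂ν = ∫⁻ y in B \ {y | h y ≤ l y}, h y ∂ν :=
    setLIntegral_congr_fun (hB.diff hD) fun y hy => sup_eq_left.2 (not_le.1 hy.2).le
  rw [e1, e2]
  refine (add_le_add (h2 _ (Set.inter_subset_left.trans hBS) (hB.inter hD))
    (h1 _ (Set.sdiff_subset.trans hBS) (hB.diff hD))).trans ?_
  refine (hT _ _ (hB.diff hD) ?_).trans_eq ?_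
  · exact Set.disjoint_sdiff_inter.symm
  · rw [Set.inter_union_sdiff]

lemma lintegral_iSup_le {Y : Type*} [MeasurableSpace Y] (ν : Measure Y) (T : Set Y → ℝ≥0∞)
    (hT : ∀ B C, MeasurableSet C → Disjoint B C → T B + T C ≤ T (B ∪ C)) (S : Set Y)
    (l : ℕ → Y → ℝ≥0∞) (hl : ∀ i, Measurable (l i))
    (h2 : ∀ i, ∀ B ⊆ S, MeasurableSet B → ∫⁻ y in B, l i y ∂ν ≤ T B)
    (B : Set Y) (hBS : B ⊆ S) (hB : MeasurableSet B) :
    ∫⁻ y in B, (⨆ i, l i y) ∂ν ≤ T B := by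
  have hm : ∀ n, Measurable (partialSups l n) ∧
      ∀ B ⊆ S, MeasurableSet B → ∫⁻ y in B, partialSups l n y ∂ν ≤ T B := by
    intro n
    induction n with
    | zero => simpa using ⟨hl 0, h2 0⟩
    | succ n ih =>
      rw [partialSups_add_one]
      refine ⟨ih.1.sup (hl _), fun B hBS hB => ?_⟩
      exact lintegral_max_le ν T hT S _ _ ih.1 (hl _) ih.2 (h2 _) B hBS hB
  have : ∀ y, (⨆ i, l i y) = ⨆ n, partialSups l n y := by
    intro y
    have := congrFun (iSup_partialSups_eq l) y
    rw [iSup_apply, iSup_apply] at this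
    exact this.symm
  simp_rw [this]
  rw [lintegral_iSup (fun n => (hm n).1) (partialSups l).monotone]
  exact iSup_le fun n => (hm n).2 B hBS hB

/-- Lower semicontinuity of the functional `F_Υ` with respect to σ-setwise convergence
of both arguments. -/
theorem stmt_5 {Y : Type*} [MeasurableSpace Y]
    (Υ : ℝ≥0∞ → ℝ≥0∞) (Υinf : ℝ≥0∞)
    (hproper : ∃ a : ℝ≥0∞, a ≠ ⊤ ∧ Υ a ≠ ⊤)
    (hconv : ∀ a b : ℝ≥0∞, a ≠ ⊤ → b ≠ ⊤ → ∀ t : ℝ≥0∞, t ≤ 1 →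
      Υ (t * a + (1 - t) * b) ≤ t * Υ a + (1 - t) * Υ b)
    (hlsc : LowerSemicontinuous Υ)
    (hrec : Tendsto (fun t : ℝ≥0 => Υ (t : ℝ≥0∞) / (t : ℝ≥0∞)) atTop (𝓝 Υinf))
    (μn νn : ℕ → Measure Y) (μ ν : Measure Y)
    [∀ n, SigmaFinite (μn n)] [∀ n, SigmaFinite (νn n)] [SigmaFinite μ] [SigmaFinite ν]
    (A : ℕ → Set Y) (hAmeas : ∀ k, MeasurableSet (A k)) (hAmono : Monotone A)
    (hAunion : ⋃ k, A k = Set.univ)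
    (hfin : ∀ k, (∀ n, μn n (A k) < ⊤ ∧ νn n (A k) < ⊤) ∧ μ (A k) < ⊤ ∧ ν (A k) < ⊤)
    (hsetμ : ∀ k, ∀ B : Set Y, MeasurableSet B →
      Tendsto (fun n => μn n (B ∩ A k)) atTop (𝓝 (μ (B ∩ A k))))
    (hsetν : ∀ k, ∀ B : Set Y, MeasurableSet B →
      Tendsto (fun n => νn n (B ∩ A k)) atTop (𝓝 (ν (B ∩ A k)))) :
    Ffun Υ Υinf μ ν ≤ Filter.liminf (fun n => Ffun Υ Υinf (μn n) (νn n)) atTop := by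
  let T : Set Y → ℝ≥0∞ := fun B => liminf (fun n => FBfun Υ Υinf (μn n) (νn n) B) atTop
  have hTadd : ∀ B C, MeasurableSet C → Disjoint B C → T B + T C ≤ T (B ∪ C) := by
    intro B C hC hd
    refine (liminf_superadd _ _).trans_eq ?_
    simp only [T]
    congr 1
    ext n
    rw [FB_add _ _ _ _ hC hd]
  have hTmono : ∀ B C, B ⊆ C → T B ≤ T C := fun B C h =>
    liminf_le_liminf (Eventually.of_forall fun n => FB_mono _ _ _ _ h)
  have hTuniv : T Set.univ = liminf (fun n => Ffun Υ Υinf (μn n) (νn n)) atTop := by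
    simp [T, FBfun, Ffun]
  have key : ∀ k, ∀ p q r s : ℝ≥0, IsAffMin Υ p q r s → ∀ B ⊆ A k, MeasurableSet B →
      (p * μ B + r * ν B) - (q * μ B + s * ν B) ≤ T B := by
    intro k p q r s h B hBk hB
    have hμ := hsetμ k B hB
    have hν := hsetν k B hB
    rw [Set.inter_eq_left.2 hBk] at hμ hν
    have hμf : μ B ≠ ⊤ := ((measure_mono hBk).trans_lt (hfin k).2.1).ne
    have hνf : ν B ≠ ⊤ := ((measure_mono hBk).trans_lt (hfin k).2.2).ne
    have lim : ∀ p r : ℝ≥0, Tendsto (fun n => p * μn n B + r * νn n B) atTop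
        (𝓝 (p * μ B + r * ν B)) := fun p r =>
      (ENNReal.Tendsto.const_mul hμ (Or.inr ENNReal.coe_ne_top)).add
        (ENNReal.Tendsto.const_mul hν (Or.inr ENNReal.coe_ne_top))
    have := ENNReal.Tendsto.sub (lim p r) (lim q s) (Or.inr (by finiteness))
    rw [← this.liminf_eq]
    refine liminf_le_liminf (Eventually.of_forall fun n => ?_)
    exact tsub_le_iff_right.2 (FB_lower Υ Υinf hrec (μn n) (νn n) h hB)
  obtain ⟨Z, hZ, hZs, hZν⟩ := Measure.mutuallySingular_singularPart μ ν
  -- `μ⊥ Z = 0`, `ν Zᶜ = 0`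
  have hρ := Measure.measurable_rnDeriv μ ν
  obtain ⟨p, q, r, s, hmin, hsup⟩ := exists_countable_min Υ hproper hconv hlsc
  have hac : ∀ k, ∫⁻ y in A k ∩ Z, Υ (μ.rnDeriv ν y) ∂ν ≤ T (A k ∩ Z) := by
    intro k
    have e : ∫⁻ y in A k ∩ Z, Υ (μ.rnDeriv ν y) ∂ν = ∫⁻ y in A k ∩ Z,
        (⨆ i, ((p i * μ.rnDeriv ν y + r i) - (q i * μ.rnDeriv ν y + s i))) ∂ν := by
      refine lintegral_congr_ae ?_
      filter_upwards [ae_restrict_of_ae (Measure.rnDeriv_lt_top μ ν)] with y hy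
      have := hsup (μ.rnDeriv ν y).toNNReal
      rwa [ENNReal.coe_toNNReal hy.ne] at this
    rw [e]
    refine lintegral_iSup_le ν T hTadd (A k ∩ Z) _ (fun i => by fun_prop) ?_ _ subset_rfl
      ((hAmeas k).inter hZ)
    intro i B hBS hB
    have hD : MeasurableSet {y | q i * μ.rnDeriv ν y + s i ≤ p i * μ.rnDeriv ν y + r i} :=
      measurableSet_le (by fun_prop) (by fun_prop)
    rw [← lintegral_inter_add_sdiff _ B hD]
    set B' := B ∩ {y | q i * μ.rnDeriv ν y + s i ≤ p i * μ.rnDeriv ν y + r i} with hB'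
    have hB'm : MeasurableSet B' := hB.inter hD
    have hB'S : B' ⊆ A k ∩ Z := Set.inter_subset_left.trans hBS
    rw [setLIntegral_congr_fun (g := fun _ => 0) (hB.diff hD)
      fun y hy => tsub_eq_zero_of_le (not_le.1 hy.2).le, lintegral_zero, add_zero]
    have hμB' : ∫⁻ y in B', μ.rnDeriv ν y ∂ν = μ B' := by
      rw [measure_decomp μ ν hB'm, measure_mono_null (hB'S.trans Set.inter_subset_right) hZs,
        add_zero]
    have hB'k := hB'S.trans Set.inter_subset_left
    have hμf : μ B' ≠ ⊤ := ((measure_mono hB'k).trans_lt (hfin k).2.1).ne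
    have hνf : ν B' ≠ ⊤ := ((measure_mono hB'k).trans_lt (hfin k).2.2).ne
    rw [lintegral_sub (by fun_prop), lintegral_aff _ _ hρ, lintegral_aff _ _ hρ, hμB']
    · exact (key k _ _ _ _ (hmin i) B' hB'k hB'm).trans (hTmono _ _ Set.inter_subset_left)
    · rw [lintegral_aff _ _ hρ, hμB']
      finiteness
    · exact ae_restrict_of_forall_mem hB'm fun y hy => hy.2
  have hsing : ∀ k, Υinf * μ.singularPart ν (A k ∩ Zᶜ) ≤ T (A k ∩ Zᶜ) := by
    intro k
    have hm : MeasurableSet (A k ∩ Zᶜ) := (hAmeas k).inter hZ.compl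
    have hν0 : ν (A k ∩ Zᶜ) = 0 := measure_mono_null Set.inter_subset_right hZν
    have hle : ∀ c : ℝ≥0, (c : ℝ≥0∞) < Υinf →
        c * μ.singularPart ν (A k ∩ Zᶜ) ≤ T (A k ∩ Zᶜ) := by
      intro c hc
      obtain ⟨s, hs⟩ := exists_slope Υ Υinf hrec c hc
      have := key k _ _ _ _ hs _ Set.inter_subset_left hm
      rw [hν0] at this
      simp only [mul_zero, add_zero, ENNReal.coe_zero, zero_mul, tsub_zero] at this
      refine le_trans ?_ this
      gcongr
      exact Measure.singularPart_le μ ν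
    refine ENNReal.mul_le_of_forall_lt fun a ha b hb => ?_
    lift a to ℝ≥0 using (ha.trans_le le_top).ne
    refine le_trans ?_ (hle a ha)
    gcongr
  have hk : ∀ k, FBfun Υ Υinf μ ν (A k) ≤ T Set.univ := by
    intro k
    have hd : Disjoint (A k ∩ Z) (A k ∩ Zᶜ) :=
      disjoint_compl_right.mono Set.inter_subset_right Set.inter_subset_right
    have hm : MeasurableSet (A k ∩ Zᶜ) := (hAmeas k).inter hZ.compl
    have hν0 : ν (A k ∩ Zᶜ) = 0 := measure_mono_null Set.inter_subset_right hZν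
    have hs0 : μ.singularPart ν (A k ∩ Z) = 0 := measure_mono_null Set.inter_subset_right hZs
    refine le_trans ?_ (hTmono (A k) _ (Set.subset_univ _))
    rw [← Set.inter_union_compl (A k) Z]
    refine le_trans ?_ (hTadd _ _ hm hd)
    rw [FB_add _ _ _ _ hm hd]
    refine add_le_add ?_ ?_
    · simpa [FBfun, hs0] using hac k
    · simpa [FBfun, Measure.restrict_eq_zero.2 hν0] using hsing k
  rw [← hTuniv]
  have h1 : Tendsto (fun k => FBfun Υ Υinf μ ν (A k)) atTop (𝓝 (Ffun Υ Υinf μ ν)) := by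
    have t2 : Tendsto (fun k => μ.singularPart ν (A k)) atTop
        (𝓝 (μ.singularPart ν Set.univ)) := by
      rw [← hAunion]; exact tendsto_measure_iUnion_atTop hAmono
    have t1 : Tendsto (fun k => ν.withDensity (fun y => Υ (μ.rnDeriv ν y)) (A k)) atTop
        (𝓝 (ν.withDensity (fun y => Υ (μ.rnDeriv ν y)) Set.univ)) := by
      rw [← hAunion]; exact tendsto_measure_iUnion_atTop hAmono
    simp only [withDensity_apply _ (hAmeas _), withDensity_apply _ MeasurableSet.univ,
      Measure.restrict_univ] at t1
    have t3 : Tendsto (fun k => Υinf * μ.singularPart ν (A k)) atTop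
        (𝓝 (Υinf * μ.singularPart ν Set.univ)) := by
      by_cases h0 : μ.singularPart ν Set.univ = 0
      · have : ∀ k, μ.singularPart ν (A k) = 0 := fun k =>
          measure_mono_null (Set.subset_univ _) h0
        simp only [this, h0]
        exact tendsto_const_nhds
      · exact ENNReal.Tendsto.const_mul t2 (Or.inl h0)
    exact t1.add t3
  exact le_of_tendsto' h1 hk
end

section
/- Let Y be a measurable space and Υ : ℝ → [0,∞] a convex, lower semicontinuous function with superlinear growth, i.e. Υ(s)/|s| → ∞ as |s| → ∞. Let (νₙ)ₙ be finite positive Borel measures converging setwise to a finite positive measure ν, and let (μₙ)ₙ be finite signed Borel measures with μₙ absolutely continuous with respect to νₙ and limsup_{n→∞} ∫_Y Υ(dμₙ/dνₙ) dνₙ < ∞. Then: (i) there exist a subsequence (μ_{n_k})_k and a finite signed measure μ such that μ_{n_k}(B) → μ(B) for every measurable B; (ii) if moreover all μₙ are positive measures and μₙ converges setwise to μ, then μ is absolutely continuous with respect to ν. -/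
open MeasureTheory Filter Topology
open scoped ENNReal

/-- The energy estimate for a single measure. -/
lemma s6_single {Y : Type*} [MeasurableSpace Y] (Υ : ℝ → ℝ≥0∞)
    (ν : Measure Y) [IsFiniteMeasure ν] (μ : SignedMeasure Y)
    (hac : ∀ B : Set Y, MeasurableSet B → ν B = 0 → μ B = 0)
    (K M C : ℝ) (hK : 0 < K) (hM : 0 ≤ M) (hC : 0 ≤ C)
    (hΥ : ∀ s : ℝ, ENNReal.ofReal |s| ≤ ENNReal.ofReal M + ENNReal.ofReal K⁻¹ * Υ s)
    (hb : ∫⁻ y, Υ (μ.rnDeriv ν y) ∂ν ≤ ENNReal.ofReal C)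
    (B : Set Y) (hB : MeasurableSet B) :
    |μ B| ≤ M * ν.real B + C / K := by
  have hac' : μ ≪ᵥ ν.toENNRealVectorMeasure := by
    refine VectorMeasure.AbsolutelyContinuous.mk fun s hs h0 => hac s hs ?_
    rwa [Measure.toENNRealVectorMeasure_apply_measurable hs] at h0
  have hint := SignedMeasure.integrable_rnDeriv μ ν
  have h1 : μ B = ∫ y in B, μ.rnDeriv ν y ∂ν := by
    conv_lhs => rw [← SignedMeasure.withDensityᵥ_rnDeriv_eq μ ν hac']
    exact withDensityᵥ_apply hint hB
  have h2 : ENNReal.ofReal |μ B| ≤ ∫⁻ y in B, ENNReal.ofReal |μ.rnDeriv ν y| ∂ν := by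
    rw [h1, ← Real.norm_eq_abs, ofReal_norm]
    refine (enorm_integral_le_lintegral_enorm _).trans (le_of_eq ?_)
    refine lintegral_congr fun y => ?_
    rw [← ofReal_norm, Real.norm_eq_abs]
  have h3 : ∫⁻ y in B, ENNReal.ofReal |μ.rnDeriv ν y| ∂ν ≤
      ENNReal.ofReal (M * ν.real B + C / K) := by
    calc _ ≤ ∫⁻ y in B, (ENNReal.ofReal M + ENNReal.ofReal K⁻¹ * Υ (μ.rnDeriv ν y)) ∂ν :=
          lintegral_mono fun y => hΥ _
      _ = ENNReal.ofReal M * ν B + ENNReal.ofReal K⁻¹ * ∫⁻ y in B, Υ (μ.rnDeriv ν y) ∂ν := by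
          rw [lintegral_add_left measurable_const, lintegral_const_mul' _ _ ENNReal.ofReal_ne_top]
          simp
      _ ≤ ENNReal.ofReal M * ν B + ENNReal.ofReal K⁻¹ * ENNReal.ofReal C := by
          gcongr
          exact (setLIntegral_le_lintegral _ _).trans hb
      _ = _ := by
          rw [← ENNReal.ofReal_mul (by positivity), ← ofReal_measureReal,
            ← ENNReal.ofReal_mul hM, ← ENNReal.ofReal_add (by positivity) (by positivity)]
          congr 1; field_simp
  exact (ENNReal.ofReal_le_ofReal_iff (by positivity)).1 (h2.trans h3)

lemma s6_super (Υ : ℝ → ℝ≥0∞)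
    (hsuper : Tendsto (fun s : ℝ => Υ s / ENNReal.ofReal |s|) (atBot ⊔ atTop) (𝓝 ⊤))
    (K : ℝ) (hK : 0 < K) : ∃ M : ℝ, 0 ≤ M ∧
    ∀ s : ℝ, ENNReal.ofReal |s| ≤ ENNReal.ofReal M + ENNReal.ofReal K⁻¹ * Υ s := by
  have h := (ENNReal.tendsto_nhds_top_iff_nnreal.1 hsuper) K.toNNReal
  rw [eventually_sup] at h
  obtain ⟨h1, h2⟩ := h
  obtain ⟨a, ha⟩ := eventually_atBot.1 h1
  obtain ⟨b, hb⟩ := eventually_atTop.1 h2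
  refine ⟨max |a| |b|, by positivity, fun s => ?_⟩
  by_cases hs : |s| ≤ max |a| |b|
  · exact (ENNReal.ofReal_le_ofReal hs).trans le_self_add
  push Not at hs
  have hlt : (K.toNNReal : ℝ≥0∞) < Υ s / ENNReal.ofReal |s| := by
    rcases le_total s 0 with h0 | h0
    · apply ha
      rw [abs_of_nonpos h0] at hs
      linarith [neg_abs_le a, le_max_left |a| |b|]
    · apply hb
      rw [abs_of_nonneg h0] at hs
      linarith [le_abs_self b, le_max_right |a| |b|]
  have hle : ENNReal.ofReal K * ENNReal.ofReal |s| ≤ Υ s := ENNReal.mul_le_of_le_div hlt.le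
  refine le_trans ?_ le_add_self
  calc ENNReal.ofReal |s| = ENNReal.ofReal K⁻¹ * (ENNReal.ofReal K * ENNReal.ofReal |s|) := by
        rw [← mul_assoc, ← ENNReal.ofReal_mul (by positivity), inv_mul_cancel₀ hK.ne']; simp
    _ ≤ _ := by gcongr

lemma s6_key {Y : Type*} [MeasurableSpace Y]
    (Υ : ℝ → ℝ≥0∞)
    (hsuper : Tendsto (fun s : ℝ => Υ s / ENNReal.ofReal |s|) (atBot ⊔ atTop) (𝓝 ⊤))
    (νn : ℕ → Measure Y) [∀ n, IsFiniteMeasure (νn n)]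
    (μn : ℕ → SignedMeasure Y)
    (hac : ∀ n, ∀ B : Set Y, MeasurableSet B → νn n B = 0 → μn n B = 0)
    (hbound : Filter.limsup
      (fun n => ∫⁻ y, Υ ((μn n).rnDeriv (νn n) y) ∂(νn n)) atTop < ⊤) :
    ∀ ε : ℝ, 0 < ε → ∃ M : ℝ, 0 ≤ M ∧ ∀ᶠ n in atTop, ∀ B : Set Y, MeasurableSet B →
      |μn n B| ≤ M * (νn n).real B + ε := by
  intro ε hε
  obtain ⟨c, hc1, hc2⟩ := exists_between hbound
  set C := c.toReal with hCdef
  have hcC : ENNReal.ofReal C = c := ENNReal.ofReal_toReal hc2.ne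
  have hC : 0 ≤ C := ENNReal.toReal_nonneg
  obtain ⟨M, hM, hΥ⟩ := s6_super Υ hsuper ((C + 1) / ε) (by positivity)
  refine ⟨M, hM, ?_⟩
  filter_upwards [eventually_lt_of_limsup_lt hc1] with n hn B hB
  refine (s6_single Υ (νn n) (μn n) (hac n) ((C + 1) / ε) M C (by positivity) hM hC hΥ
    (hcC ▸ hn.le) B hB).trans ?_
  gcongr
  rw [div_le_iff₀ (by positivity)]
  field_simp
  linarith

lemma s6_cauchy (x : ℕ → ℝ) (h : ∀ ε : ℝ, 0 < ε → ∃ (y : ℕ → ℝ) (l : ℝ),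
    Tendsto y atTop (𝓝 l) ∧ ∀ᶠ n in atTop, |x n - y n| ≤ ε) :
    ∃ l, Tendsto x atTop (𝓝 l) := by
  apply cauchySeq_tendsto_of_complete
  rw [Metric.cauchySeq_iff']
  intro ε hε
  obtain ⟨y, l, hy, hxy⟩ := h (ε / 5) (by positivity)
  have h2 := (Metric.tendsto_nhds.1 hy) (ε / 5) (by positivity)
  obtain ⟨N, hN⟩ := eventually_atTop.1 (hxy.and h2)
  refine ⟨N, fun n hn => ?_⟩
  have a1 := hN n hn
  have a2 := hN N le_rfl
  rw [Real.dist_eq] at *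
  have b1 := abs_le.1 a1.1
  have b2 := abs_le.1 a2.1
  have b3 := abs_lt.1 a1.2
  have b4 := abs_lt.1 a2.2
  rw [abs_lt]
  constructor <;> linarith

/-- Tails of disjoint unions. -/
lemma s6_split {Y : Type*} [MeasurableSpace Y] (μ : SignedMeasure Y) (f : ℕ → Set Y)
    (hd : Pairwise (Function.onFun Disjoint f)) (hf : ∀ i, MeasurableSet (f i)) (s : Finset ℕ) :
    μ (⋃ i, f i) = ∑ i ∈ s, μ (f i) + μ ((⋃ i, f i) \ ⋃ i ∈ s, f i) := by
  rw [← VectorMeasure.of_biUnion_finset (fun i _ j _ hij => hd hij) (fun i _ => hf i)]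
  exact (VectorMeasure.of_add_of_sdiff (Finset.measurableSet_biUnion s fun i _ => hf i)
    (MeasurableSet.iUnion hf) (Set.iUnion₂_subset fun i _ => Set.subset_iUnion f i)).symm

lemma s6_tail {Y : Type*} [MeasurableSpace Y] (ν : Measure Y) [IsFiniteMeasure ν] (f : ℕ → Set Y)
    (hd : Pairwise (Function.onFun Disjoint f)) (hf : ∀ i, MeasurableSet (f i)) :
    Tendsto (fun s : Finset ℕ => ν.real ((⋃ i, f i) \ ⋃ i ∈ s, f i)) atTop (𝓝 0) := by
  have h := VectorMeasure.hasSum_of_disjoint_iUnion (v := ν.toSignedMeasure) hf hd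
  have h2 : Tendsto (fun s : Finset ℕ => ν.toSignedMeasure (⋃ i, f i) -
      ∑ i ∈ s, ν.toSignedMeasure (f i)) atTop (𝓝 0) := by
    simpa using (tendsto_const_nhds (x := ν.toSignedMeasure (⋃ i, f i))).sub h
  refine h2.congr fun s => ?_
  rw [s6_split ν.toSignedMeasure f hd hf s, add_sub_cancel_left,
    Measure.toSignedMeasure_apply_measurable]
  exact (MeasurableSet.iUnion hf).diff (Finset.measurableSet_biUnion s fun i _ => hf i)

/-- Convergence extends from a pi-system to the generated sigma-algebra. -/
lemma s6_gen {Y : Type*} (m : MeasurableSpace Y) [m0 : MeasurableSpace Y] (ν : Measure Y) [IsFiniteMeasure ν]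
    (a : ℕ → SignedMeasure Y)
    (hU : ∀ ε : ℝ, 0 < ε → ∃ δ : ℝ, 0 < δ ∧ ∀ B : Set Y, MeasurableSet B → ν.real B < δ →
      ∀ᶠ n in atTop, |a n B| ≤ ε)
    (hm : m ≤ m0)
    (A : Set (Set Y)) (hA : IsPiSystem A) (huniv : Set.univ ∈ A)
    (hmA : m = MeasurableSpace.generateFrom A)
    (hconv : ∀ B ∈ A, ∃ l, Tendsto (fun n => a n B) atTop (𝓝 l)) :
    ∀ B, MeasurableSet[m] B → ∃ l, Tendsto (fun n => a n B) atTop (𝓝 l) := by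
  intro B hB
  induction B, hB using MeasurableSpace.induction_on_inter hmA hA with
  | empty => exact ⟨0, by simp⟩
  | basic t ht => exact hconv t ht
  | compl t ht ih =>
    obtain ⟨l, hl⟩ := ih
    obtain ⟨l', hl'⟩ := hconv _ huniv
    refine ⟨l' - l, (hl'.sub hl).congr fun n => ?_⟩
    rw [VectorMeasure.of_compl (hm _ ht)]
  | iUnion f hd hf ih =>
    choose l hl using ih
    apply s6_cauchy
    intro ε hε
    obtain ⟨δ, hδ, hU'⟩ := hU ε hε
    have hf' : ∀ i, MeasurableSet (f i) := fun i => hm _ (hf i)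
    have ht := s6_tail ν f hd hf'
    obtain ⟨s, hs⟩ := (ht.eventually (gt_mem_nhds hδ)).exists
    refine ⟨fun n => ∑ i ∈ s, a n (f i), ∑ i ∈ s, l i, tendsto_finsetSum _ fun i _ => hl i, ?_⟩
    filter_upwards [hU' _ ((MeasurableSet.iUnion hf').diff
      (Finset.measurableSet_biUnion s fun i _ => hf' i)) hs] with n hn
    rw [s6_split (a n) f hd hf' s, add_sub_cancel_left]
    exact hn

/-- Construction of the limit. -/
lemma s6_limit {Y : Type*} [m0 : MeasurableSpace Y] (ν : Measure Y) [IsFiniteMeasure ν]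
    (a : ℕ → SignedMeasure Y)
    (hU : ∀ ε : ℝ, 0 < ε → ∃ δ : ℝ, 0 < δ ∧ ∀ B : Set Y, MeasurableSet B → ν.real B < δ →
      ∀ᶠ n in atTop, |a n B| ≤ ε)
    (hconv : ∀ B, MeasurableSet B → ∃ l, Tendsto (fun n => a n B) atTop (𝓝 l)) :
    ∃ μ : SignedMeasure Y, ∀ B : Set Y, MeasurableSet B →
        Tendsto (fun k => a k B) atTop (𝓝 (μ B)) := by
  have hconv' : ∀ B : Set Y, ∃ l, Tendsto (fun n => a n B) atTop (𝓝 l) := by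
    intro B
    by_cases hB : MeasurableSet B
    · exact hconv B hB
    · exact ⟨0, by simp [VectorMeasure.not_measurable _ hB]⟩
  choose L hL using hconv'
  refine ⟨⟨L, ?_, ?_, ?_⟩, fun B _ => hL B⟩
  · exact tendsto_nhds_unique (hL ∅) (by simp)
  · intro B hB
    exact tendsto_nhds_unique (hL B) (by simp [VectorMeasure.not_measurable _ hB])
  · intro f hf hd
    have key : ∀ s : Finset ℕ, L (⋃ i, f i) - L ((⋃ i, f i) \ ⋃ i ∈ s, f i) =
        ∑ i ∈ s, L (f i) := by
      intro s
      refine tendsto_nhds_unique ((hL _).sub (hL _)) ?_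
      refine (tendsto_finsetSum s fun i _ => hL (f i)).congr fun n => ?_
      rw [s6_split (a n) f hd hf s, add_sub_cancel_right]
    have h0 : Tendsto (fun s : Finset ℕ => L ((⋃ i, f i) \ ⋃ i ∈ s, f i)) atTop (𝓝 0) := by
      rw [Metric.tendsto_nhds]
      intro ε hε
      obtain ⟨δ, hδ, hU'⟩ := hU (ε / 2) (by positivity)
      filter_upwards [(s6_tail ν f hd hf).eventually (gt_mem_nhds hδ)] with s hs
      have h1 := hU' _ ((MeasurableSet.iUnion hf).diff
        (Finset.measurableSet_biUnion s fun i _ => hf i)) hs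
      have h2 := le_of_tendsto (hL _).abs h1
      rw [Real.dist_eq, sub_zero]
      linarith
    have h1 := (tendsto_const_nhds (x := L (⋃ i, f i))).sub h0
    rw [sub_zero] at h1
    exact h1.congr key

/-- Convergence of integrals of bounded measurable functions with values in `[0,1]`. -/
lemma s6_integral {Y : Type*} (m : MeasurableSpace Y) [m0 : MeasurableSpace Y] (lam : Measure Y) 
    (hm : m ≤ m0)
    (h : ℕ → Y → ℝ) (hint : ∀ n, Integrable (h n) lam)
    (R : ℝ) (hR : ∀ᶠ n in atTop, ∫ y, |h n y| ∂lam ≤ R)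
    (hconv : ∀ B, MeasurableSet[m] B → ∃ l, Tendsto (fun n => ∫ y in B, h n y ∂lam) atTop (𝓝 l))
    (g : Y → ℝ) (hg : Measurable[m] g) (hg01 : ∀ᵐ y ∂lam, 0 ≤ g y ∧ g y ≤ 1) :
    ∃ l, Tendsto (fun n => ∫ y, g y * h n y ∂lam) atTop (𝓝 l) := by
  apply s6_cauchy
  intro ε hε
  obtain ⟨k, hk⟩ := exists_nat_gt (max (R / ε) 1)
  have hk1 : (1 : ℝ) < k := (le_max_right _ _).trans_lt hk
  have hkR : R / k ≤ ε := by
    have := (le_max_left (R / ε) 1).trans_lt hk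
    rw [div_lt_iff₀ hε] at this
    rw [div_le_iff₀ (by linarith)]
    linarith
  let E : ℕ → Set Y := fun j => {y | ⌊(k : ℝ) * g y⌋₊ = j}
  have hE : ∀ j, MeasurableSet[m] (E j) := fun j =>
    (Nat.measurable_floor.comp (measurable_const.mul hg)) (measurableSet_singleton j)
  choose l hl using fun j => hconv (E j) (hE j)
  refine ⟨fun n => ∑ j ∈ Finset.range (k + 1), (j / k : ℝ) * ∫ y in E j, h n y ∂lam,
    ∑ j ∈ Finset.range (k + 1), (j / k : ℝ) * l j,
    tendsto_finsetSum _ fun j _ => (hl j).const_mul _, ?_⟩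
  filter_upwards [hR] with n hn
  let ψ : Y → ℝ := fun y => ∑ j ∈ Finset.range (k + 1), (j / k : ℝ) * (E j).indicator (h n) y
  have hψi : ∀ j ∈ Finset.range (k + 1),
      Integrable (fun y => (j / k : ℝ) * (E j).indicator (h n) y) lam := fun j _ =>
    ((hint n).indicator (hm _ (hE j))).const_mul _
  have hψint : Integrable ψ lam := integrable_finsetSum _ hψi
  have e1 : ∑ j ∈ Finset.range (k + 1), (j / k : ℝ) * ∫ y in E j, h n y ∂lam = ∫ y, ψ y ∂lam := by
    rw [integral_finsetSum _ hψi]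
    refine Finset.sum_congr rfl fun j _ => ?_
    rw [integral_const_mul, integral_indicator (hm _ (hE j))]
  have hgint : Integrable (fun y => g y * h n y) lam := by
    refine (hint n).bdd_mul (c := 1) (hg.mono hm le_rfl).aestronglyMeasurable ?_
    filter_upwards [hg01] with y hy
    rw [Real.norm_eq_abs, abs_of_nonneg hy.1]
    exact hy.2
  rw [e1, ← integral_sub hgint hψint]
  refine (abs_integral_le_integral_abs).trans ?_
  refine le_trans (b := ∫ y, (1 / k : ℝ) * |h n y| ∂lam) ?_ ?_
  · refine integral_mono_ae (hgint.sub hψint).abs ((hint n).abs.const_mul _) ?_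
    filter_upwards [hg01] with y hy
    have hf : ⌊(k : ℝ) * g y⌋₊ ∈ Finset.range (k + 1) := by
      rw [Finset.mem_range, Nat.lt_succ_iff]
      exact Nat.floor_le_of_le (by nlinarith [hy.2])
    have hψy : ψ y = (⌊(k : ℝ) * g y⌋₊ / k : ℝ) * h n y := by
      simp only [ψ]
      rw [Finset.sum_eq_single_of_mem _ hf]
      · rw [Set.indicator_of_mem]; rfl
      · intro j _ hj
        rw [Set.indicator_of_notMem, mul_zero]
        exact fun hmem => hj (Eq.symm hmem)
    change |g y * h n y - ψ y| ≤ _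
    rw [hψy, ← sub_mul, abs_mul]
    gcongr
    have c1 := Nat.floor_le (a := (k : ℝ) * g y) (mul_nonneg (by linarith) hy.1)
    have c2 := (Nat.lt_floor_add_one ((k : ℝ) * g y)).le
    have : g y - (⌊(k : ℝ) * g y⌋₊ / k : ℝ) = (k * g y - ⌊(k : ℝ) * g y⌋₊) / k := by
      field_simp
    rw [this, abs_div, abs_of_nonneg (by linarith : (0:ℝ) ≤ k)]
    gcongr
    rw [abs_le]; constructor <;> linarith
  · rw [integral_const_mul]
    calc (1 / k : ℝ) * ∫ y, |h n y| ∂lam ≤ (1 / k : ℝ) * R := by gcongr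
      _ = R / k := by ring
      _ ≤ ε := hkR

lemma s6_condexp {Y : Type*} (m : MeasurableSpace Y) [m0 : MeasurableSpace Y] (lam : Measure Y) [IsFiniteMeasure lam]
    (hm : m ≤ m0)
    (h : ℕ → Y → ℝ) (hint : ∀ n, Integrable (h n) lam) (hmeas : ∀ n, Measurable[m] (h n))
    (R : ℝ) (hR : ∀ᶠ n in atTop, ∫ y, |h n y| ∂lam ≤ R)
    (hconv : ∀ B, MeasurableSet[m] B → ∃ l, Tendsto (fun n => ∫ y in B, h n y ∂lam) atTop (𝓝 l))
    (B : Set Y) (hB : MeasurableSet B) :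
    ∃ l, Tendsto (fun n => ∫ y in B, h n y ∂lam) atTop (𝓝 l) := by
  let χ : Y → ℝ := B.indicator fun _ => 1
  have hχ : Integrable χ lam := (integrable_const 1).indicator hB
  have h0 : 0 ≤ᵐ[lam] lam[χ | m] :=
    condExp_nonneg (ae_of_all _ fun y => Set.indicator_nonneg (fun _ _ => zero_le_one) y)
  have h1 : lam[χ | m] ≤ᵐ[lam] fun _ => 1 := by
    have := condExp_mono (m := m) hχ (integrable_const (1 : ℝ))
      (ae_of_all lam fun y => Set.indicator_le_self' (s := B) (f := fun _ => (1:ℝ)) (fun _ _ => zero_le_one) y)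
    rwa [condExp_const hm] at this
  obtain ⟨l, hl⟩ := s6_integral m lam hm h hint R hR hconv (lam[χ | m])
    stronglyMeasurable_condExp.measurable (by filter_upwards [h0, h1] with y a b using ⟨a, b⟩)
  refine ⟨l, hl.congr fun n => ?_⟩
  have hmul : χ * h n = B.indicator (h n) := by
    ext y
    by_cases hy : y ∈ B <;> simp [χ, hy]
  have e := condExp_mul_of_stronglyMeasurable_right (m := m) (μ := lam) (f := χ) (g := h n)
    (hmeas n).stronglyMeasurable (by rw [hmul]; exact (hint n).indicator hB) hχ
  calc ∫ y, (lam[χ | m]) y * h n y ∂lam = ∫ y, (lam[χ * h n | m]) y ∂lam :=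
        (integral_congr_ae e).symm
    _ = ∫ y, (χ * h n) y ∂lam := integral_condExp hm
    _ = _ := by rw [hmul, integral_indicator hB]

lemma s6_subseq {Y : Type*} [MeasurableSpace Y] (a : ℕ → SignedMeasure Y) (R : ℝ)
    (hR : ∀ᶠ n in atTop, ∀ B, MeasurableSet B → |a n B| ≤ R)
    (A : Set (Set Y)) (hA : A.Countable) (hAm : ∀ B ∈ A, MeasurableSet B) :
    ∃ φ : ℕ → ℕ, StrictMono φ ∧
      ∀ B ∈ A, ∃ l, Tendsto (fun n => a (φ n) B) atTop (𝓝 l) := by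
  have : Countable A := hA.to_subtype
  have hc : IsCompact (Set.univ.pi fun _ : A => Set.Icc (-R) R) :=
    isCompact_univ_pi fun _ => isCompact_Icc
  have hx : ∃ᶠ n in atTop, (fun B : A => a n B) ∈ Set.univ.pi fun _ : A => Set.Icc (-R) R := by
    refine Eventually.frequently ?_
    filter_upwards [hR] with n hn B _
    exact abs_le.1 (hn B (hAm B B.2))
  obtain ⟨x, _, φ, hφ, hlim⟩ := hc.tendsto_subseq' hx
  refine ⟨φ, hφ, fun B hB => ⟨x ⟨B, hB⟩, ?_⟩⟩
  exact (tendsto_pi_nhds.1 hlim) ⟨B, hB⟩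

lemma s6_compact_aux {Y : Type*} (m : MeasurableSpace Y) [m0 : MeasurableSpace Y] (hm : m ≤ m0)
    (hcg : @MeasurableSpace.CountablyGenerated Y m)
    (ν : Measure Y) [IsFiniteMeasure ν] (lam : Measure Y) [IsFiniteMeasure lam]
    (a : ℕ → SignedMeasure Y) (h : ℕ → Y → ℝ) (hint : ∀ n, Integrable (h n) lam)
    (hm0 : ∀ n, Measurable (h n)) (hmeas : ∀ n, Measurable[m] (h n))
    (hval : ∀ n B, MeasurableSet B → a n B = ∫ y in B, h n y ∂lam)
    (hU : ∀ ε : ℝ, 0 < ε → ∃ δ : ℝ, 0 < δ ∧ ∀ B : Set Y, MeasurableSet B → ν.real B < δ →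
      ∀ᶠ n in atTop, |a n B| ≤ ε)
    (R : ℝ) (hR : ∀ᶠ n in atTop, ∀ B, MeasurableSet B → |a n B| ≤ R) :
    ∃ φ : ℕ → ℕ, StrictMono φ ∧ ∃ μ : SignedMeasure Y,
      ∀ B : Set Y, MeasurableSet B →
        Tendsto (fun k => a (φ k) B) atTop (𝓝 (μ B)) := by
  obtain ⟨b, hbc, hb⟩ := hcg.isCountablyGenerated
  let A := generateSetAlgebra b
  have hAalg : IsSetAlgebra A := isSetAlgebra_generateSetAlgebra
  have hmA : m = MeasurableSpace.generateFrom A := by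
    rw [hb]; exact generateFrom_generateSetAlgebra_eq.symm
  have hAm : ∀ B ∈ A, MeasurableSet[m0] B := fun B hB => hm _ (by
    rw [hmA]; exact MeasurableSpace.measurableSet_generateFrom hB)
  obtain ⟨φ, hφ, hlim⟩ := s6_subseq a R hR A (countable_generateSetAlgebra hbc) hAm
  have hUφ : ∀ ε : ℝ, 0 < ε → ∃ δ : ℝ, 0 < δ ∧ ∀ B : Set Y, MeasurableSet B → ν.real B < δ →
      ∀ᶠ n in atTop, |a (φ n) B| ≤ ε := by
    intro ε hε
    obtain ⟨δ, hδ, h'⟩ := hU ε hε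
    exact ⟨δ, hδ, fun B hB hlt => hφ.tendsto_atTop.eventually (h' B hB hlt)⟩
  have hRφ := hφ.tendsto_atTop.eventually hR
  have hg := s6_gen m ν (fun n => a (φ n)) hUφ hm A (fun s hs t ht _ => hAalg.inter_mem hs ht)
    hAalg.univ_mem hmA hlim
  refine ⟨φ, hφ, s6_limit ν (fun n => a (φ n)) hUφ fun B hB => ?_⟩
  simp only [hval _ _ hB]
  refine s6_condexp m lam hm (fun n => h (φ n)) (fun n => hint _) (fun n => hmeas _) (R + R) ?_ ?_
    B hB
  · filter_upwards [hRφ] with n hn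
    have hP : MeasurableSet {y | 0 ≤ h (φ n) y} := measurableSet_le measurable_const (hm0 _)
    have e1 := integral_add_compl hP (hint (φ n)).abs
    have e2 : ∫ y in {y | 0 ≤ h (φ n) y}, |h (φ n) y| ∂lam = a (φ n) {y | 0 ≤ h (φ n) y} := by
      rw [hval _ _ hP]
      exact setIntegral_congr_fun hP fun y hy => abs_of_nonneg hy
    have e3 : ∫ y in {y | 0 ≤ h (φ n) y}ᶜ, |h (φ n) y| ∂lam = -a (φ n) {y | 0 ≤ h (φ n) y}ᶜ := by
      rw [hval _ _ hP.compl, ← integral_neg]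
      exact setIntegral_congr_fun hP.compl fun y hy => abs_of_neg (not_le.1 hy)
    rw [← e1, e2, e3]
    have b1 := abs_le.1 (hn _ hP)
    have b2 := abs_le.1 (hn _ hP.compl)
    linarith
  · intro B hB
    obtain ⟨l, hl⟩ := hg B hB
    exact ⟨l, hl.congr fun n => hval _ _ (hm _ hB)⟩

lemma s6_compact {Y : Type*} [m0 : MeasurableSpace Y]
    (νn : ℕ → Measure Y) (ν : Measure Y)
    [∀ n, IsFiniteMeasure (νn n)] [IsFiniteMeasure ν]
    (a : ℕ → SignedMeasure Y)
    (hac : ∀ n, ∀ B : Set Y, MeasurableSet B → νn n B = 0 → a n B = 0)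
    (hU : ∀ ε : ℝ, 0 < ε → ∃ δ : ℝ, 0 < δ ∧ ∀ B : Set Y, MeasurableSet B → ν.real B < δ →
      ∀ᶠ n in atTop, |a n B| ≤ ε)
    (R : ℝ) (hR : ∀ᶠ n in atTop, ∀ B, MeasurableSet B → |a n B| ≤ R) :
    ∃ φ : ℕ → ℕ, StrictMono φ ∧ ∃ μ : SignedMeasure Y,
      ∀ B : Set Y, MeasurableSet B →
        Tendsto (fun k => a (φ k) B) atTop (𝓝 (μ B)) := by
  let lam : Measure Y := (Measure.sum νn).toFinite
  have hac' : ∀ n, a n ≪ᵥ lam.toENNRealVectorMeasure := by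
    intro n
    refine VectorMeasure.AbsolutelyContinuous.mk fun s hs h0 => hac n s hs ?_
    rw [Measure.toENNRealVectorMeasure_apply_measurable hs] at h0
    have h1 : Measure.sum νn s = 0 := absolutelyContinuous_toFinite _ h0
    exact Measure.absolutelyContinuous_sum_right n (Measure.AbsolutelyContinuous.refl _) h1
  let h : ℕ → Y → ℝ := fun n => (a n).rnDeriv lam
  have hint : ∀ n, Integrable (h n) lam := fun n => SignedMeasure.integrable_rnDeriv _ _
  have hm0 : ∀ n, Measurable (h n) := fun n => SignedMeasure.measurable_rnDeriv _ _
  have hval : ∀ n B, MeasurableSet B → a n B = ∫ y in B, h n y ∂lam := by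
    intro n B hB
    conv_lhs => rw [← SignedMeasure.withDensityᵥ_rnDeriv_eq (a n) lam (hac' n)]
    exact withDensityᵥ_apply (hint n) hB
  let H : Y → ℕ → ℝ := fun y n => h n y
  have hH : Measurable H := measurable_pi_iff.2 hm0
  exact s6_compact_aux (MeasurableSpace.comap H inferInstance) hH.comap_le
    (MeasurableSpace.CountablyGenerated.comap H) ν lam a h hint hm0
    (fun n => (measurable_pi_apply n).comp (comap_measurable H)) hval hU R hR

/-- Setwise compactness from superlinear integral bounds: if finite measures `νn`
converge setwise to `ν`, the finite signed measures `μn` are absolutely continuous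
with respect to `νn`, and the superlinear energies `∫ Υ(dμn/dνn) dνn` are bounded,
then (i) a subsequence of `(μn)` converges setwise to a finite signed measure, and
(ii) any setwise limit of such a sequence of positive measures is absolutely
continuous with respect to `ν`. -/
theorem stmt_6 {Y : Type*} [MeasurableSpace Y]
    (Υ : ℝ → ℝ≥0∞)
    (hconv : ∀ a b t : ℝ, 0 ≤ t → t ≤ 1 →
      Υ (t * a + (1 - t) * b) ≤ ENNReal.ofReal t * Υ a + ENNReal.ofReal (1 - t) * Υ b)
    (hlsc : LowerSemicontinuous Υ)
    (hsuper : Tendsto (fun s : ℝ => Υ s / ENNReal.ofReal |s|) (atBot ⊔ atTop) (𝓝 ⊤))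
    (νn : ℕ → Measure Y) (ν : Measure Y)
    [∀ n, IsFiniteMeasure (νn n)] [IsFiniteMeasure ν]
    (hsetν : ∀ B : Set Y, MeasurableSet B →
      Tendsto (fun n => νn n B) atTop (𝓝 (ν B)))
    (μn : ℕ → SignedMeasure Y)
    (hac : ∀ n, ∀ B : Set Y, MeasurableSet B → νn n B = 0 → μn n B = 0)
    (hbound : Filter.limsup
      (fun n => ∫⁻ y, Υ ((μn n).rnDeriv (νn n) y) ∂(νn n)) atTop < ⊤) :
    (∃ φ : ℕ → ℕ, StrictMono φ ∧ ∃ μ : SignedMeasure Y,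
      ∀ B : Set Y, MeasurableSet B →
        Tendsto (fun k => μn (φ k) B) atTop (𝓝 (μ B))) ∧
    (∀ μ : SignedMeasure Y,
      (∀ n, ∀ B : Set Y, MeasurableSet B → 0 ≤ μn n B) →
      (∀ B : Set Y, MeasurableSet B → Tendsto (fun n => μn n B) atTop (𝓝 (μ B))) →
      ∀ B : Set Y, MeasurableSet B → ν B = 0 → μ B = 0) := by
  have hν : ∀ B : Set Y, MeasurableSet B →
      Tendsto (fun n => (νn n).real B) atTop (𝓝 (ν.real B)) := fun B hB =>
    (ENNReal.tendsto_toReal (measure_ne_top ν B)).comp (hsetν B hB)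
  have hkey := s6_key Υ hsuper νn μn hac hbound
  have hU : ∀ ε : ℝ, 0 < ε → ∃ δ : ℝ, 0 < δ ∧ ∀ B : Set Y, MeasurableSet B → ν.real B < δ →
      ∀ᶠ n in atTop, |μn n B| ≤ ε := by
    intro ε hε
    obtain ⟨M, hM, h⟩ := hkey (ε / 2) (by positivity)
    refine ⟨ε / (2 * (M + 1)), by positivity, fun B hB hlt => ?_⟩
    filter_upwards [h, (hν B hB).eventually (gt_mem_nhds hlt)] with n h1 h2
    refine (h1 B hB).trans ?_
    have h3 : M * (νn n).real B ≤ ε / 2 := by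
      calc M * (νn n).real B ≤ (M + 1) * (ε / (2 * (M + 1))) := by gcongr; linarith
        _ = ε / 2 := by field_simp
    linarith
  refine ⟨?_, ?_⟩
  · obtain ⟨M, hM, h⟩ := hkey 1 one_pos
    refine s6_compact νn ν μn hac hU (M * (ν.real Set.univ + 1) + 1) ?_
    filter_upwards [h, (hν Set.univ MeasurableSet.univ).eventually
      (gt_mem_nhds (lt_add_one _))] with n h1 h2 B hB
    refine (h1 B hB).trans ?_
    have h3 : (νn n).real B ≤ (νn n).real Set.univ := measureReal_mono (Set.subset_univ _)
    gcongr
    exact h3.trans h2.le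
  · intro μ _ hμ B hB h0
    have h1 : ∀ ε : ℝ, 0 < ε → |μ B| ≤ 0 + ε := by
      intro ε hε
      obtain ⟨δ, hδ, h⟩ := hU ε hε
      rw [zero_add]
      exact le_of_tendsto (hμ B hB).abs (h B hB (by simpa [Measure.real, h0] using hδ))
    exact abs_nonpos_iff.1 (le_of_forall_pos_le_add h1)
end

section
/- Let ψ* : ℝ → [0,∞) be convex, differentiable, even, with ψ*(0) = 0, and suppose there are constants c₀ > 0 and r > 0 such that ψ*(x) ≤ (3/2)·c₀·x² for all x with |x| ≤ r. Then for every η ∈ [−1,1] and every ζ ∈ ℝ one has ψ*(η·ζ) ≤ η²·( (3/2)·c₀·ζ² + (ζ²/r²)·ψ*(ζ) ). -/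
open Set

/-- Key structural estimate for the dual dissipation density: if `ψ*` is convex,
differentiable, even, vanishing at `0`, nonnegative, and bounded above by a quadratic
near zero (`ψ*(x) ≤ (3/2)c₀x²` for `|x| ≤ r`), then for all `η ∈ [-1,1]` and `ζ ∈ ℝ`,
`ψ*(ηζ) ≤ η²((3/2)c₀ζ² + (ζ²/r²)ψ*(ζ))`. -/
theorem stmt_8 (ψs : ℝ → ℝ)
    (hconv : ConvexOn ℝ Set.univ ψs)
    (hdiff : Differentiable ℝ ψs)
    (heven : ∀ x, ψs (-x) = ψs x)
    (hnonneg : ∀ x, 0 ≤ ψs x)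
    (h0 : ψs 0 = 0)
    (c₀ r : ℝ) (hc₀ : 0 < c₀) (hr : 0 < r)
    (hquad : ∀ x : ℝ, |x| ≤ r → ψs x ≤ (3 / 2) * c₀ * x ^ 2) :
    ∀ η ζ : ℝ, η ∈ Set.Icc (-1 : ℝ) 1 →
      ψs (η * ζ) ≤ η ^ 2 * ((3 / 2) * c₀ * ζ ^ 2 + (ζ ^ 2 / r ^ 2) * ψs ζ) := by
  intro η ζ hη
  obtain ⟨h1, h2⟩ := hη
  by_cases h : |η * ζ| ≤ r
  · have hq := hquad _ h
    have hp : 0 ≤ η ^ 2 * ((ζ ^ 2 / r ^ 2) * ψs ζ) :=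
      mul_nonneg (sq_nonneg _) (mul_nonneg (by positivity) (hnonneg ζ))
    calc ψs (η * ζ) ≤ (3 / 2) * c₀ * (η * ζ) ^ 2 := hq
      _ ≤ (3 / 2) * c₀ * (η * ζ) ^ 2 + η ^ 2 * ((ζ ^ 2 / r ^ 2) * ψs ζ) := by linarith
      _ = _ := by ring
  · have hlt : r < |η * ζ| := not_le.mp h
    have hm : ψs (η * ζ) ≤ ψs ζ := by
      have hc := hconv.2 (mem_univ ζ) (mem_univ (-ζ))
        (show (0:ℝ) ≤ (1 + η) / 2 by linarith) (show (0:ℝ) ≤ (1 - η) / 2 by linarith) (by ring)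
      simp only [smul_eq_mul, heven] at hc
      have e : (1 + η) / 2 * ζ + (1 - η) / 2 * -ζ = η * ζ := by ring
      rw [e] at hc
      linarith
    have hsq : r ^ 2 ≤ (η * ζ) ^ 2 := by
      rw [← sq_abs (η * ζ)]
      exact pow_le_pow_left₀ hr.le hlt.le 2
    have h1' : 1 ≤ (η * ζ) ^ 2 / r ^ 2 := by
      rw [le_div_iff₀ (by positivity)]
      linarith
    have hp : 0 ≤ (3 / 2) * c₀ * (η * ζ) ^ 2 := by positivity
    calc ψs (η * ζ) ≤ ψs ζ := hm
      _ ≤ (η * ζ) ^ 2 / r ^ 2 * ψs ζ := le_mul_of_one_le_left (hnonneg ζ) h1'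
      _ ≤ (3 / 2) * c₀ * (η * ζ) ^ 2 + (η * ζ) ^ 2 / r ^ 2 * ψs ζ := by linarith
      _ = _ := by ring
end

section
/- Let ν : ℝᵈ → [0,∞) be measurable with ν(−h) = ν(h) for all h and ∫_{ℝᵈ} (1 ∧ |h|²) ν(h) dh = C_ν < ∞. Let γ : ℝᵈ → [0,∞) be measurable, bounded, integrable, and such that for every R > 0 there is c_R > 0 with γ(x) ≥ c_R for Lebesgue-a.e. x with |x| ≤ R. Fix m ≥ 1 and let (hₙ)ₙ be measurable functions with |hₙ| ≤ 2 everywhere, hₙ(x) = 0 for |x| > m+1, and hₙ → 0 Lebesgue-a.e. Then ∫∫_{ℝᵈ×ℝᵈ} |hₙ(x) − hₙ(y)|² ν(x−y) dx dy → 0 if and only if ∫∫_{ℝᵈ×ℝᵈ} |hₙ(x) − hₙ(y)|² γ(x)γ(y) ν(x−y) dx dy → 0. -/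
open MeasureTheory Filter Topology Set
open scoped ENNReal

/-- Equivalence of the unweighted and `γ`-weighted nonlocal Dirichlet energies along a
sequence of uniformly bounded, compactly supported functions `hₙ` vanishing a.e.:
`∬ |hₙ(x)-hₙ(y)|² ν(x-y) dx dy → 0` iff `∬ |hₙ(x)-hₙ(y)|² γ(x)γ(y) ν(x-y) dx dy → 0`. -/
theorem stmt_13 (d : ℕ)
    (ν : EuclideanSpace ℝ (Fin d) → ℝ)
    (hνmeas : Measurable ν) (hνnonneg : ∀ h, 0 ≤ ν h)
    (hνsymm : ∀ h, ν (-h) = ν h)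
    (Cν : ℝ≥0∞) (hCν : Cν ≠ ⊤)
    (hνint : ∫⁻ h, ENNReal.ofReal (min 1 (‖h‖ ^ 2) * ν h) ∂volume = Cν)
    (γ : EuclideanSpace ℝ (Fin d) → ℝ)
    (hγmeas : Measurable γ) (hγnonneg : ∀ x, 0 ≤ γ x)
    (hγbdd : ∃ C : ℝ, ∀ x, γ x ≤ C)
    (hγint : ∫⁻ x, ENNReal.ofReal (γ x) ∂volume < ⊤)
    (hγpos : ∀ R : ℝ, 0 < R → ∃ c : ℝ, 0 < c ∧ ∀ᵐ x ∂volume, ‖x‖ ≤ R → c ≤ γ x)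
    (m : ℕ) (hm : 1 ≤ m)
    (hseq : ℕ → EuclideanSpace ℝ (Fin d) → ℝ)
    (hmeas : ∀ n, Measurable (hseq n))
    (hbdd : ∀ n x, |hseq n x| ≤ 2)
    (hsupp : ∀ n x, (m : ℝ) + 1 < ‖x‖ → hseq n x = 0)
    (hae : ∀ᵐ x ∂volume, Tendsto (fun n => hseq n x) atTop (𝓝 0)) :
    Tendsto (fun n => ∫⁻ p : EuclideanSpace ℝ (Fin d) × EuclideanSpace ℝ (Fin d),
        ENNReal.ofReal ((hseq n p.1 - hseq n p.2) ^ 2 * ν (p.1 - p.2))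
        ∂(volume.prod volume)) atTop (𝓝 0) ↔
    Tendsto (fun n => ∫⁻ p : EuclideanSpace ℝ (Fin d) × EuclideanSpace ℝ (Fin d),
        ENNReal.ofReal ((hseq n p.1 - hseq n p.2) ^ 2 * γ p.1 * γ p.2 * ν (p.1 - p.2))
        ∂(volume.prod volume)) atTop (𝓝 0) := by
  obtain ⟨C, hC⟩ := hγbdd
  constructor
  · intro h
    have h2 := ENNReal.Tendsto.const_mul (a := ENNReal.ofReal (C ^ 2)) h
      (Or.inr ENNReal.ofReal_ne_top)
    rw [mul_zero] at h2
    refine tendsto_of_tendsto_of_tendsto_of_le_of_le tendsto_const_nhds h2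
      (fun _ => zero_le) (fun n => ?_)
    simp only
    rw [← lintegral_const_mul' _ _ ENNReal.ofReal_ne_top]
    refine lintegral_mono (fun p => ?_)
    simp only
    rw [← ENNReal.ofReal_mul (sq_nonneg C)]
    apply ENNReal.ofReal_le_ofReal
    have h1 : γ p.1 * γ p.2 ≤ C ^ 2 := by
      rw [sq]
      exact mul_le_mul (hC _) (hC _) (hγnonneg _) ((hγnonneg p.1).trans (hC _))
    have h3 := mul_le_mul_of_nonneg_right h1
      (mul_nonneg (sq_nonneg (hseq n p.1 - hseq n p.2)) (hνnonneg (p.1 - p.2)))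
    linarith
  · intro h
    have hm0 : (0 : ℝ) ≤ m := Nat.cast_nonneg m
    obtain ⟨c, hc, hcγ⟩ := hγpos ((m : ℝ) + 2) (by linarith)
    have h2 := ENNReal.Tendsto.const_mul (a := ENNReal.ofReal ((c ^ 2)⁻¹)) h
      (Or.inr ENNReal.ofReal_ne_top)
    rw [mul_zero] at h2
    have hL : Tendsto (fun n => ∫⁻ x, ENNReal.ofReal (hseq n x ^ 2)
        ∂(volume : Measure (EuclideanSpace ℝ (Fin d)))) atTop (𝓝 0) := by
      have := tendsto_lintegral_of_dominated_convergence
        (μ := (volume : Measure (EuclideanSpace ℝ (Fin d))))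
        (F := fun n x => ENNReal.ofReal (hseq n x ^ 2)) (f := fun _ => 0)
        ((Metric.closedBall 0 ((m : ℝ) + 1)).indicator (fun _ => ENNReal.ofReal 4))
        (fun n => ((hmeas n).pow_const 2).ennreal_ofReal)
        (fun n => Eventually.of_forall (fun x => ?_)) ?_ ?_
      · simpa using this
      · by_cases hx : x ∈ Metric.closedBall (0 : EuclideanSpace ℝ (Fin d)) ((m : ℝ) + 1)
        · rw [indicator_of_mem hx]
          apply ENNReal.ofReal_le_ofReal
          have := abs_le.1 (hbdd n x)
          nlinarith
        · have : hseq n x = 0 := hsupp n x (by simpa using hx)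
          simp [this]
      · rw [lintegral_indicator_const Metric.isClosed_closedBall.measurableSet]
        exact ENNReal.mul_ne_top ENNReal.ofReal_ne_top measure_closedBall_lt_top.ne
      · filter_upwards [hae] with x hx
        have := ENNReal.tendsto_ofReal (hx.pow 2)
        simpa using this
    have h3 := ENNReal.Tendsto.mul_const (b := Cν) hL (Or.inr hCν)
    rw [zero_mul] at h3
    have h4 := (h2.add h3).add h3
    rw [add_zero, add_zero] at h4
    refine tendsto_of_tendsto_of_tendsto_of_le_of_le tendsto_const_nhds h4
      (fun _ => zero_le) (fun n => ?_)
    simp only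
    set g : EuclideanSpace ℝ (Fin d) → ℝ≥0∞ :=
      fun h => ENNReal.ofReal (min 1 (‖h‖ ^ 2) * ν h) with hg
    have hgm : Measurable g := by
      apply Measurable.ennreal_ofReal
      exact (measurable_const.min (measurable_norm.pow_const 2)).mul hνmeas
    have hf : Measurable (fun x => ENNReal.ofReal (hseq n x ^ 2)) :=
      ((hmeas n).pow_const 2).ennreal_ofReal
    have e1 : ∫⁻ p : EuclideanSpace ℝ (Fin d) × EuclideanSpace ℝ (Fin d),
        ENNReal.ofReal (hseq n p.1 ^ 2) * g (p.1 - p.2) ∂(volume.prod volume)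
        = (∫⁻ x, ENNReal.ofReal (hseq n x ^ 2)) * Cν := by
      rw [lintegral_prod _ (by fun_prop), ← lintegral_mul_const _ hf]
      congr 1; ext x
      simp only
      rw [lintegral_const_mul' _ _ ENNReal.ofReal_ne_top, lintegral_sub_left_eq_self g x, hνint]
    have e2 : ∫⁻ p : EuclideanSpace ℝ (Fin d) × EuclideanSpace ℝ (Fin d),
        ENNReal.ofReal (hseq n p.2 ^ 2) * g (p.1 - p.2) ∂(volume.prod volume)
        = (∫⁻ x, ENNReal.ofReal (hseq n x ^ 2)) * Cν := by
      rw [lintegral_prod_symm _ (by fun_prop), ← lintegral_mul_const _ hf]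
      congr 1; ext x
      simp only
      rw [lintegral_const_mul' _ _ ENNReal.ofReal_ne_top, lintegral_sub_right_eq_self g x, hνint]
    rw [← lintegral_const_mul' _ _ ENNReal.ofReal_ne_top]
    nth_rewrite 1 [← e1]
    rw [← e2, ← lintegral_add_right _ (by fun_prop), ← lintegral_add_right _ (by fun_prop)]
    apply lintegral_mono_ae
    have q1 := (Measure.quasiMeasurePreserving_fst
      (μ := (volume : Measure (EuclideanSpace ℝ (Fin d))))
      (ν := (volume : Measure (EuclideanSpace ℝ (Fin d))))).ae hcγ
    have q2 := (Measure.quasiMeasurePreserving_snd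
      (μ := (volume : Measure (EuclideanSpace ℝ (Fin d))))
      (ν := (volume : Measure (EuclideanSpace ℝ (Fin d))))).ae hcγ
    filter_upwards [q1, q2] with p hp1 hp2
    by_cases a1 : ‖p.1‖ ≤ (m : ℝ) + 2
    · by_cases a2 : ‖p.2‖ ≤ (m : ℝ) + 2
      · refine le_trans ?_ (le_trans le_self_add le_self_add)
        rw [← ENNReal.ofReal_mul (by positivity)]
        apply ENNReal.ofReal_le_ofReal
        rw [inv_mul_eq_div, le_div_iff₀ (by positivity)]
        have h1 : c ^ 2 ≤ γ p.1 * γ p.2 := by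
          rw [sq]
          exact mul_le_mul (hp1 a1) (hp2 a2) hc.le (hγnonneg _)
        have h3 := mul_le_mul_of_nonneg_right h1
          (mul_nonneg (sq_nonneg (hseq n p.1 - hseq n p.2)) (hνnonneg (p.1 - p.2)))
        linarith
      · push Not at a2
        have z : hseq n p.2 = 0 := hsupp n _ (by linarith)
        refine le_trans ?_ (le_trans le_add_self le_self_add)
        by_cases b : ‖p.1‖ ≤ (m : ℝ) + 1
        · have hn : 1 ≤ ‖p.1 - p.2‖ := by
            have := norm_sub_norm_le p.2 p.1
            rw [norm_sub_rev] at this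
            linarith
          rw [hg]
          simp only
          rw [z, sub_zero, min_eq_left (by nlinarith), one_mul,
            ENNReal.ofReal_mul (sq_nonneg _)]
        · have z1 : hseq n p.1 = 0 := hsupp n _ (by linarith)
          simp [z, z1]
    · push Not at a1
      have z : hseq n p.1 = 0 := hsupp n _ (by linarith)
      refine le_trans ?_ le_add_self
      by_cases b : ‖p.2‖ ≤ (m : ℝ) + 1
      · have hn : 1 ≤ ‖p.1 - p.2‖ := by
          have := norm_sub_norm_le p.1 p.2
          linarith
        rw [hg]
        simp only
        rw [z, zero_sub, neg_sq, min_eq_left (by nlinarith), one_mul,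
          ENNReal.ofReal_mul (sq_nonneg _)]
      · have z1 : hseq n p.2 = 0 := hsupp n _ (by linarith)
        simp [z, z1]
end

section
/- Let (V,d) be a separable metric space, π a finite positive Borel measure on V, and (κ(x,·))_{x∈V} a family of Borel measures on V with κ(x,{x}) = 0 for every x, such that for every bounded Borel f : V → ℝ the map x ↦ ∫_V f(y)(1 ∧ d(x,y)²) κ(x,dy) is Borel measurable, and c_κ := sup_{x∈V} ∫_V (1 ∧ d(x,y)²) κ(x,dy) < ∞. Let θ_κ be the σ-finite measure on V × V given by θ_κ(C) = ∫_V κ(x, {y : (x,y)∈C}) π(dx). Let (aₙ)ₙ be Borel functions aₙ : V × V → [0,1] with aₙ → 1 θ_κ-a.e., and let (ρⁿ)ₙ be finite positive Borel measures on V, each absolutely continuous with respect to π, converging setwise to ρ. Then: (i) the finite measures C ↦ ∫∫ 1_C(x,y) aₙ(x,y)(1 ∧ d(x,y)²) κ(x,dy) π(dx) converge setwise to C ↦ ∫∫ 1_C(x,y)(1 ∧ d(x,y)²) κ(x,dy) π(dx); (ii) the finite measures C ↦ ∫∫ 1_C(x,y) aₙ(x,y)(1 ∧ d(x,y)²) κ(x,dy)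 ρⁿ(dx) converge setwise to C ↦ ∫∫ 1_C(x,y)(1 ∧ d(x,y)²) κ(x,dy) ρ(dx). -/
open MeasureTheory Filter Topology Set
open scoped ENNReal

/-- Sliced weighted coupling with multiplier `a`:
`TkerA a κ x C = ∫ 1_C(x,y) a(x,y) (1 ∧ d(x,y)²) κ(x,dy)`. -/
noncomputable def TkerA {V : Type*} [MetricSpace V] [MeasurableSpace V]
    (a : V × V → ℝ) (κ : V → Measure V) (x : V) (C : Set (V × V)) : ℝ≥0∞ :=
  ∫⁻ y, C.indicator (fun _ => (1 : ℝ≥0∞)) (x, y) * ENNReal.ofReal (a (x, y)) *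
    ENNReal.ofReal (min 1 (dist x y ^ 2)) ∂(κ x)

lemma aux_bdd {V : Type*} [MeasurableSpace V] (ρn : ℕ → Measure V) (ρ : Measure V)
    [IsFiniteMeasure ρ]
    (hset : ∀ B : Set V, MeasurableSet B → Tendsto (fun n => ρn n B) atTop (𝓝 (ρ B)))
    (c : ℝ≥0∞) (hc : c ≠ ⊤) (h : V → ℝ≥0∞) (hm : Measurable h) (hb : ∀ x, h x ≤ c) :
    Tendsto (fun n => ∫⁻ x, h x ∂(ρn n)) atTop (𝓝 (∫⁻ x, h x ∂ρ)) := by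
  have key : ∀ μ : Measure V,
      ∫⁻ x, h x ∂μ = ∫⁻ t in Ioi (0:ℝ), μ {x | t < (h x).toReal} := by
    intro μ
    rw [← lintegral_eq_lintegral_meas_lt μ (f := fun x => (h x).toReal)
      (Eventually.of_forall fun x => ENNReal.toReal_nonneg) hm.ennreal_toReal.aemeasurable]
    refine lintegral_congr fun x => ?_
    rw [ENNReal.ofReal_toReal (ne_top_of_le_ne_top hc (hb x))]
  simp_rw [key]
  have hM : ∀ᶠ n in atTop, ρn n univ ≤ ρ univ + 1 := by
    have h1 : ρ univ < ρ univ + 1 :=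
      ENNReal.lt_add_right (measure_ne_top _ _) one_ne_zero
    filter_upwards [(hset univ MeasurableSet.univ).eventually (gt_mem_nhds h1)] with n hn
    exact hn.le
  refine tendsto_lintegral_filter_of_dominated_convergence
    ((Iio c.toReal).indicator fun _ => ρ univ + 1) ?_ ?_ ?_ ?_
  · refine Eventually.of_forall fun n => ?_
    refine Antitone.measurable ?_
    intro s t hst
    exact measure_mono fun x (hx : t < _) => lt_of_le_of_lt hst hx
  · filter_upwards [hM] with n hn
    refine Eventually.of_forall fun t => ?_
    by_cases ht : t < c.toReal
    · rw [indicator_of_mem (show t ∈ Iio c.toReal from ht)]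
      exact (measure_mono (subset_univ _)).trans hn
    · have : {x | t < (h x).toReal} = ∅ := by
        ext x
        simp only [mem_setOf_eq, mem_empty_iff_false, iff_false, not_lt]
        exact (ENNReal.toReal_mono hc (hb x)).trans (not_lt.1 ht)
      rw [this]; simp
  · rw [lintegral_indicator measurableSet_Iio, lintegral_const,
      Measure.restrict_restrict measurableSet_Iio, Measure.restrict_apply_univ]
    refine ENNReal.mul_ne_top (by simp) ?_
    rw [Iio_inter_Ioi]
    simp
  · refine Eventually.of_forall fun t => ?_
    exact hset _ (measurableSet_lt measurable_const hm.ennreal_toReal)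

lemma aux_conv {V : Type*} [MeasurableSpace V] (ρn : ℕ → Measure V) (ρ : Measure V)
    [IsFiniteMeasure ρ]
    (hset : ∀ B : Set V, MeasurableSet B → Tendsto (fun n => ρn n B) atTop (𝓝 (ρ B)))
    (c : ℝ≥0∞) (hc : c ≠ ⊤) (F : ℕ → V → ℝ≥0∞) (G : V → ℝ≥0∞)
    (hm : ∀ n, Measurable (F n)) (hb : ∀ n x, F n x ≤ c)
    (hlim : ∀ᵐ x ∂ρ, Tendsto (fun n => F n x) atTop (𝓝 (G x))) :
    Tendsto (fun n => ∫⁻ x, F n x ∂(ρn n)) atTop (𝓝 (∫⁻ x, G x ∂ρ)) := by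
  have hmi : ∀ m, Measurable fun x => ⨅ k, F (k + m) x := fun m =>
    Measurable.iInf fun k => hm _
  have hms : ∀ m, Measurable fun x => ⨆ k, F (k + m) x := fun m =>
    Measurable.iSup fun k => hm _
  have hbs : ∀ m x, ⨆ k, F (k + m) x ≤ c := fun m x => iSup_le fun k => hb _ _
  have hbi : ∀ m x, ⨅ k, F (k + m) x ≤ c := fun m x => (iInf_le _ 0).trans (hb _ _)
  have hfin : ∫⁻ _, c ∂ρ ≠ ⊤ := by
    rw [lintegral_const]; exact ENNReal.mul_ne_top hc (measure_ne_top _ _)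
  have h1 : Tendsto (fun m => ∫⁻ x, ⨅ k, F (k + m) x ∂ρ) atTop (𝓝 (∫⁻ x, G x ∂ρ)) := by
    refine tendsto_lintegral_of_dominated_convergence (fun _ => c) hmi
      (fun m => Eventually.of_forall (hbi m)) hfin ?_
    filter_upwards [hlim] with x hx
    have := hx.liminf_eq
    rw [liminf_eq_iSup_iInf_of_nat'] at this
    rw [← this]
    refine tendsto_atTop_iSup ?_
    intro a b hab
    refine le_iInf fun k => ?_
    obtain ⟨d, rfl⟩ := Nat.exists_eq_add_of_le hab
    refine (iInf_le _ (k + d)).trans (le_of_eq ?_)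
    congr 1; omega
  have h2 : Tendsto (fun m => ∫⁻ x, ⨆ k, F (k + m) x ∂ρ) atTop (𝓝 (∫⁻ x, G x ∂ρ)) := by
    refine tendsto_lintegral_of_dominated_convergence (fun _ => c) hms
      (fun m => Eventually.of_forall (hbs m)) hfin ?_
    filter_upwards [hlim] with x hx
    have := hx.limsup_eq
    rw [limsup_eq_iInf_iSup_of_nat'] at this
    rw [← this]
    refine tendsto_atTop_iInf ?_
    intro a b hab
    refine iSup_le fun k => ?_
    obtain ⟨d, rfl⟩ := Nat.exists_eq_add_of_le hab
    refine le_trans (le_of_eq ?_) (le_iSup _ (k + d))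
    congr 1; omega
  refine tendsto_order.2 ⟨fun a ha => ?_, fun a ha => ?_⟩
  · obtain ⟨m, hmm⟩ := (h1.eventually (lt_mem_nhds ha)).exists
    filter_upwards [(aux_bdd ρn ρ hset c hc _ (hmi m) (hbi m)).eventually (lt_mem_nhds hmm),
      eventually_ge_atTop m] with n hn hnm
    refine hn.trans_le (lintegral_mono fun x => ?_)
    refine (iInf_le _ (n - m)).trans (le_of_eq ?_)
    rw [Nat.sub_add_cancel hnm]
  · obtain ⟨m, hmm⟩ := (h2.eventually (gt_mem_nhds ha)).exists
    filter_upwards [(aux_bdd ρn ρ hset c hc _ (hms m) (hbs m)).eventually (gt_mem_nhds hmm),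
      eventually_ge_atTop m] with n hn hnm
    refine lt_of_le_of_lt (lintegral_mono fun x => ?_) hn
    refine le_trans (le_of_eq ?_) (le_iSup _ (n - m))
    rw [Nat.sub_add_cancel hnm]

/-- Robustness of the weighted couplings under kernel regularization: if
`aₙ : V × V → [0,1]` converge to `1` θ_κ-a.e. and the finite measures `ρⁿ ≪ π`
converge setwise to `ρ`, then the weighted couplings
`(1 ∧ d²)θ_{κₙ} → (1 ∧ d²)θ_κ` and `(1 ∧ d²)θ⁻_{ρⁿ,κₙ} → (1 ∧ d²)θ⁻_{ρ,κ}` setwise. -/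
theorem stmt_19 {V : Type*} [MetricSpace V] [TopologicalSpace.SeparableSpace V]
    [MeasurableSpace V] [BorelSpace V]
    (piV : Measure V) [IsFiniteMeasure piV]
    (κ : V → Measure V) (hdiag : ∀ x, κ x {x} = 0)
    (hmeas : ∀ f : V → ℝ, Measurable f → (∃ C : ℝ, ∀ y, |f y| ≤ C) →
      Measurable fun x => ∫ y, f y * min 1 (dist x y ^ 2) ∂(κ x))
    (c : ℝ≥0∞) (hc : c ≠ ⊤)
    (hbound : ∀ x, ∫⁻ y, ENNReal.ofReal (min 1 (dist x y ^ 2)) ∂(κ x) ≤ c)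
    (an : ℕ → V × V → ℝ)
    (hanmeas : ∀ n, Measurable (an n))
    (han01 : ∀ n p, an n p ∈ Set.Icc (0 : ℝ) 1)
    (hae : ∫⁻ x, κ x {y | ¬ Tendsto (fun n => an n (x, y)) atTop (𝓝 1)} ∂piV = 0)
    (ρn : ℕ → Measure V) (ρ : Measure V)
    [∀ n, IsFiniteMeasure (ρn n)] [IsFiniteMeasure ρ]
    (hacn : ∀ n, ρn n ≪ piV)
    (hset : ∀ B : Set V, MeasurableSet B →
      Tendsto (fun n => ρn n B) atTop (𝓝 (ρ B))) :
    (∀ C : Set (V × V), MeasurableSet C →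
      Tendsto (fun n => ∫⁻ x, TkerA (an n) κ x C ∂piV) atTop
        (𝓝 (∫⁻ x, TkerA (fun _ => 1) κ x C ∂piV))) ∧
    (∀ C : Set (V × V), MeasurableSet C →
      Tendsto (fun n => ∫⁻ x, TkerA (an n) κ x C ∂(ρn n)) atTop
        (𝓝 (∫⁻ x, TkerA (fun _ => 1) κ x C ∂ρ))) := by
  haveI : SecondCountableTopology V := UniformSpace.secondCountable_of_separable V
  have hwm : ∀ x : V, Measurable fun y => ENNReal.ofReal (min 1 (dist x y ^ 2)) := by
    intro x; fun_prop
  have hνm : Measurable fun x =>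
      (κ x).withDensity fun y => ENNReal.ofReal (min 1 (dist x y ^ 2)) := by
    refine Measure.measurable_of_measurable_coe _ fun s hs => ?_
    have h0 := (hmeas (s.indicator fun _ => 1) (measurable_const.indicator hs)
      ⟨1, fun y => by by_cases hy : y ∈ s <;> simp [hy]⟩).ennreal_ofReal
    convert h0 using 2 with x
    rw [withDensity_apply _ hs, ← lintegral_indicator hs, integral_eq_lintegral_of_nonneg_ae]
    · have he : ∀ y, ENNReal.ofReal (s.indicator (fun _ => (1:ℝ)) y * min 1 (dist x y ^ 2))
          = s.indicator (fun y => ENNReal.ofReal (min 1 (dist x y ^ 2))) y := by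
        intro y
        by_cases hy : y ∈ s <;> simp [hy]
      simp_rw [he]
      rw [ENNReal.ofReal_toReal]
      refine ne_top_of_le_ne_top hc (le_trans (lintegral_mono fun y => ?_) (hbound x))
      exact indicator_le_self _ _ _
    · refine Eventually.of_forall fun y => ?_
      refine mul_nonneg (indicator_nonneg (fun _ _ => zero_le_one) _) (by positivity)
    · refine Measurable.aestronglyMeasurable ?_
      exact (measurable_const.indicator hs).mul (by fun_prop)
  let ν : ProbabilityTheory.Kernel V V := ⟨_, hνm⟩
  have hν : ∀ x, ν x = (κ x).withDensity fun y => ENNReal.ofReal (min 1 (dist x y ^ 2)) :=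
    fun _ => rfl
  have hνc : ∀ x, ν x univ ≤ c := fun x => by
    rw [hν, withDensity_apply _ MeasurableSet.univ, Measure.restrict_univ]
    exact hbound x
  haveI : ProbabilityTheory.IsFiniteKernel ν := ⟨c, hc.lt_top, hνc⟩
  have hρ : ρ ≪ piV := by
    refine Measure.AbsolutelyContinuous.mk fun s hs h0 => ?_
    have h1 := hset s hs
    simp_rw [fun n => hacn n h0] at h1
    exact tendsto_nhds_unique h1 tendsto_const_nhds
  have hbadm : MeasurableSet {p : V × V | ¬ Tendsto (fun n => an n p) atTop (𝓝 1)} :=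
    (measurableSet_tendsto (𝓝 1) hanmeas).compl
  have hbad : ∀ᵐ x ∂piV, ∀ᵐ y ∂(ν x), Tendsto (fun n => an n (x, y)) atTop (𝓝 1) := by
    have hmb := ProbabilityTheory.Kernel.measurable_kernel_prodMk_left (κ := ν) hbadm
    have h0 : ∫⁻ x, ν x (Prod.mk x ⁻¹' {p : V × V | ¬ Tendsto (fun n => an n p) atTop (𝓝 1)})
        ∂piV = 0 := by
      refine le_antisymm (le_trans (lintegral_mono fun x => ?_) hae.le) zero_le
      have hs := measurable_prodMk_left (x := x) hbadm
      rw [hν, withDensity_apply _ hs]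
      refine le_trans (lintegral_mono (g := fun _ => 1) fun y => ?_) ?_
      · exact ENNReal.ofReal_le_one.2 (min_le_left _ _)
      · rw [setLIntegral_one]; rfl
    rw [lintegral_eq_zero_iff hmb] at h0
    filter_upwards [h0] with x hx
    exact hx
  have main : ∀ C : Set (V × V), MeasurableSet C →
      (∀ n, Measurable fun x => TkerA (an n) κ x C) ∧ (∀ n x, TkerA (an n) κ x C ≤ c) ∧
      ∀ᵐ x ∂piV, Tendsto (fun n => TkerA (an n) κ x C) atTop
        (𝓝 (TkerA (fun _ => 1) κ x C)) := by
    intro C hC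
    have hCm : Measurable (C.indicator (fun _ => (1 : ℝ≥0∞))) := measurable_const.indicator hC
    have hT : ∀ a : V × V → ℝ, Measurable a → ∀ x, TkerA a κ x C =
        ∫⁻ y, C.indicator (fun _ => (1 : ℝ≥0∞)) (x, y) * ENNReal.ofReal (a (x, y)) ∂(ν x) := by
      intro a ha x
      rw [hν, lintegral_withDensity_eq_lintegral_mul _ (hwm x)]
      · refine lintegral_congr fun y => ?_
        simp only [Pi.mul_apply]
        rw [mul_comm]
      · exact (hCm.comp measurable_prodMk_left).mul
          (ha.comp measurable_prodMk_left).ennreal_ofReal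
    have hle : ∀ n x y,
        C.indicator (fun _ => (1 : ℝ≥0∞)) (x, y) * ENNReal.ofReal (an n (x, y)) ≤ 1 := by
      intro n x y
      refine mul_le_one' ?_ (ENNReal.ofReal_le_one.2 (han01 n _).2)
      exact indicator_le_self _ (fun _ => (1 : ℝ≥0∞)) _
    refine ⟨fun n => ?_, fun n x => ?_, ?_⟩
    · simp_rw [hT _ (hanmeas n)]
      exact Measurable.lintegral_kernel_prod_right'
        (f := fun p => C.indicator (fun _ => (1 : ℝ≥0∞)) p * ENNReal.ofReal (an n p))
        (hCm.mul (hanmeas n).ennreal_ofReal)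
    · rw [hT _ (hanmeas n)]
      refine (lintegral_mono (hle n x)).trans ?_
      rw [lintegral_one]; exact hνc x
    · filter_upwards [hbad] with x hx
      simp_rw [fun n => hT _ (hanmeas n) x]
      rw [hT _ measurable_const]
      refine tendsto_lintegral_of_dominated_convergence (fun _ => 1) (fun n => ?_)
        (fun n => Eventually.of_forall (hle n x)) ?_ ?_
      · exact (hCm.comp measurable_prodMk_left).mul
          ((hanmeas n).comp measurable_prodMk_left).ennreal_ofReal
      · rw [lintegral_one]; exact ne_top_of_le_ne_top hc (hνc x)
      · filter_upwards [hx] with y hy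
        refine ENNReal.Tendsto.const_mul (ENNReal.tendsto_ofReal hy) (Or.inl ?_)
        simp
  refine ⟨fun C hC => ?_, fun C hC => ?_⟩
  · obtain ⟨h1, h2, h3⟩ := main C hC
    exact aux_conv (fun _ => piV) piV (fun _ _ => tendsto_const_nhds) c hc _ _ h1 h2 h3
  · obtain ⟨h1, h2, h3⟩ := main C hC
    exact aux_conv ρn ρ hset c hc _ _ h1 h2 (hρ.ae_le h3)
end
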